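/- Finite Morse index implies almost stability in one out of m+1 disjoint sets (Euclidean version): let n ≥ 1, s ∈ (0,1), ε > 0 and m ∈ ℕ. Let u : ℝ^n → (-1,1) be a Lipschitz, continuously differentiable solution of the fractional Allen–Cahn equation with parameters s, ε on all of ℝ^n, with Morse index at most m in ℝ^n. Let U₁,…,U_{m+1} ⊆ ℝ^n be pairwise disjoint open sets with dist(U_i,U_j) > 0 for i ≠ j, and set Λ := m · max_{i≠j} sup_{(p,q)∈U_i×U_j} α_{n,s}·|p-q|^{-(n+s)}. Then there exists k ∈ {1,…,m+1} such that u is Λ-almost stable in U_k, i.e. Q_{ℝ^n}(ξ) ≥ -Λ·(∫_{U_k} |ξ| dx)² for every ξ ∈ C_c¹(U_k). -/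

import Mathlib

open MeasureTheory Real Set Metric Filter Topology

noncomputable section

/-- Euclidean `n`-space. -/
abbrev Rn (n : ℕ) : Type := EuclideanSpace ℝ (Fin n)

/-- The normalizing constant `α_{n,s}` of the fractional Laplacian kernel. -/
def alphaC (n : ℕ) (s : ℝ) : ℝ :=
  s * 2 ^ (s - 1) * Real.Gamma (((n : ℝ) + s) / 2) /
    (Real.pi ^ ((n : ℝ) / 2) * Real.Gamma (1 - s / 2))

/-- The fractional kernel `α_{n,s} |x-y|^{-(n+s)}`. -/
def fracKer (n : ℕ) (s : ℝ) (x y : Rn n) : ℝ :=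
  alphaC n s * ‖x - y‖ ^ (-((n : ℝ) + s))

/-- The double-well potential `W(t) = (1-t²)²/4`. -/
def Wpot (t : ℝ) : ℝ := (1 - t ^ 2) ^ 2 / 4

/-- `u` solves the fractional Allen–Cahn equation
`(-Δ)^{s/2} u + ε^{-s} W'(u) = 0` (with `W'(t) = t³ - t`) in the open set `O`. -/
def IsACSol (n : ℕ) (s ε : ℝ) (u : Rn n → ℝ) (O : Set (Rn n)) : Prop :=
  ∀ x ∈ O, (∫ y, (u x - u y) * fracKer n s x y) + ε ^ (-s) * (u x ^ 3 - u x) = 0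

/-- The second-variation quadratic form of the fractional Allen–Cahn energy at `u` in `Ω`,
with `W''(t) = 3t² - 1`. -/
def Qform (n : ℕ) (s ε : ℝ) (u : Rn n → ℝ) (Ω : Set (Rn n)) (ξ : Rn n → ℝ) : ℝ :=
  (1 / 4) * (∫ p in ((Ωᶜ ×ˢ Ωᶜ)ᶜ : Set (Rn n × Rn n)),
      (ξ p.1 - ξ p.2) ^ 2 * fracKer n s p.1 p.2) +
    ε ^ (-s) * ∫ x in Ω, (3 * u x ^ 2 - 1) * ξ x ^ 2

/-- `ξ` is a `C¹` function compactly supported in `Ω`. -/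
def IsCc1On (n : ℕ) (Ω : Set (Rn n)) (ξ : Rn n → ℝ) : Prop :=
  ContDiff ℝ 1 ξ ∧ HasCompactSupport ξ ∧ tsupport ξ ⊆ Ω

/-- The Morse index of `u` in `Ω` is at most `m`: there is no `(m+1)`-dimensional subspace
of `C_c¹(Ω)` on which the second variation is negative definite. -/
def ACMorseIndexLE (n : ℕ) (s ε : ℝ) (u : Rn n → ℝ) (Ω : Set (Rn n)) (m : ℕ) : Prop :=
  ∀ ξ : Fin (m + 1) → Rn n → ℝ, (∀ i, IsCc1On n Ω (ξ i)) → LinearIndependent ℝ ξ →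
    ∃ a : Fin (m + 1) → ℝ, a ≠ 0 ∧ 0 ≤ Qform n s ε u Ω (fun x => ∑ i, a i * ξ i x)

/-- `u` is `Λ`-almost stable in `Ω`: `Q_Ω(ξ) ≥ -Λ (∫_Ω |ξ|)²` for all `ξ ∈ C_c¹(Ω)`. -/
def AlmostStable (n : ℕ) (s ε Λ : ℝ) (u : Rn n → ℝ) (Ω : Set (Rn n)) : Prop :=
  ∀ ξ : Rn n → ℝ, IsCc1On n Ω ξ → -(Λ * (∫ x in Ω, |ξ x|) ^ 2) ≤ Qform n s ε u Ω ξ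

end

noncomputable section

/-- Distance between two subsets of a metric space. -/
def setDist {α : Type*} [PseudoMetricSpace α] (A B : Set α) : ℝ :=
  sInf (Set.image2 dist A B)

section Kernel

variable {n : ℕ} {s : ℝ}

lemma alphaC_pos (n : ℕ) (hs : s ∈ Ioo (0 : ℝ) 1) : 0 < alphaC n s := by
  obtain ⟨h0, h1⟩ := hs
  have hG1 : 0 < Real.Gamma (((n : ℝ) + s) / 2) := Real.Gamma_pos_of_pos (by positivity)
  have hG2 : 0 < Real.Gamma (1 - s / 2) := Real.Gamma_pos_of_pos (by linarith)
  unfold alphaC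
  positivity

lemma fracKer_nonneg (hs : s ∈ Ioo (0 : ℝ) 1) (x y : Rn n) : 0 ≤ fracKer n s x y :=
  mul_nonneg (alphaC_pos n hs).le (by positivity)

lemma fracKer_add_right (x z : Rn n) : fracKer n s x (x + z) = fracKer n s z 0 := by
  simp [fracKer]

lemma measurable_fracKer_zero : Measurable fun z : Rn n => fracKer n s z 0 := by
  unfold fracKer
  fun_prop

/-- The measure `α_{n,s} |z|^{-(n+s)} dz` of jumps. -/
def jumpMeasure (n : ℕ) (s : ℝ) : Measure (Rn n) :=
  volume.withDensity fun z => ENNReal.ofReal (fracKer n s z 0)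

instance : SFinite (jumpMeasure n s) := by
  unfold jumpMeasure
  infer_instance

lemma integral_jumpMeasure (hs : s ∈ Ioo (0 : ℝ) 1) (F : Rn n → ℝ) :
    ∫ z, F z ∂jumpMeasure n s = ∫ z, F z * fracKer n s z 0 := by
  unfold jumpMeasure
  rw [integral_withDensity_eq_integral_toReal_smul measurable_fracKer_zero.ennreal_ofReal
    (by simp)]
  simp only [ENNReal.toReal_ofReal (fracKer_nonneg hs _ _), smul_eq_mul, mul_comm]

lemma integrable_jumpMeasure_iff (hs : s ∈ Ioo (0 : ℝ) 1) {F : Rn n → ℝ} :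
    Integrable F (jumpMeasure n s) ↔ Integrable fun z => F z * fracKer n s z 0 := by
  unfold jumpMeasure
  rw [integrable_withDensity_iff_integrable_smul' measurable_fracKer_zero.ennreal_ofReal
    (by simp)]
  simp only [ENNReal.toReal_ofReal (fracKer_nonneg hs _ _), smul_eq_mul, mul_comm]

lemma fracKer_smul {t : ℝ} (ht : 0 < t) (z : Rn n) :
    fracKer n s z 0 = t ^ ((n : ℝ) + s) * fracKer n s (t • z) 0 := by
  simp only [fracKer, sub_zero, norm_smul, Real.norm_eq_abs, abs_of_pos ht]
  rw [Real.mul_rpow ht.le (norm_nonneg _), Real.rpow_neg ht.le]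
  have : t ^ ((n : ℝ) + s) ≠ 0 := (Real.rpow_pos_of_pos ht _).ne'
  field_simp

lemma integrable_jumpMeasure_comp_smul (hs : s ∈ Ioo (0 : ℝ) 1) {F : Rn n → ℝ} {t : ℝ}
    (ht : 0 < t) (hF : Integrable F (jumpMeasure n s)) :
    Integrable (fun z => F (t • z)) (jumpMeasure n s) := by
  rw [integrable_jumpMeasure_iff hs] at hF ⊢
  have h := ((integrable_comp_smul_iff volume _ ht.ne').2 hF).const_mul (t ^ ((n : ℝ) + s))
  refine h.congr (ae_of_all _ fun z => ?_)
  simp only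
  rw [fracKer_smul ht z]
  ring

lemma integral_jumpMeasure_comp_smul (hs : s ∈ Ioo (0 : ℝ) 1) (F : Rn n → ℝ) {t : ℝ}
    (ht : 0 < t) :
    ∫ z, F (t • z) ∂jumpMeasure n s = t ^ s * ∫ z, F z ∂jumpMeasure n s := by
  rw [integral_jumpMeasure hs, integral_jumpMeasure hs]
  have h := Measure.integral_comp_smul volume (fun z : Rn n => F z * fracKer n s z 0) t
  have h2 : ∀ z : Rn n, F (t • z) * fracKer n s z 0 =
      t ^ ((n : ℝ) + s) * (F (t • z) * fracKer n s (t • z) 0) := fun z => by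
    rw [fracKer_smul ht z]; ring
  simp only [h2]
  rw [integral_const_mul, h, Real.rpow_add ht, Real.rpow_natCast]
  have : t ^ n ≠ 0 := by positivity
  simp only [finrank_euclideanSpace, Fintype.card_fin, smul_eq_mul]
  rw [abs_of_pos (by positivity)]
  field_simp

lemma integrable_min_one_norm (hn : 1 ≤ n) (hs : s ∈ Ioo (0 : ℝ) 1) :
    Integrable (fun z : Rn n => min 1 ‖z‖) (jumpMeasure n s) := by
  have : Nontrivial (Rn n) := by
    have : Nonempty (Fin n) := ⟨⟨0, hn⟩⟩
    infer_instance
  rw [integrable_jumpMeasure_iff hs]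
  simp only [fracKer, sub_zero]
  rw [integrable_fun_norm_addHaar volume (f := fun r => min 1 r * (alphaC n s * r ^ (-((n : ℝ) + s))))]
  simp only [finrank_euclideanSpace, Fintype.card_fin, smul_eq_mul]
  have key : ∀ r : ℝ, 0 < r → r ^ (n - 1) * (min 1 r * (alphaC n s * r ^ (-((n : ℝ) + s)))) =
      alphaC n s * (min 1 r * r ^ (-1 - s)) := by
    intro r hr
    have h1 : r ^ (-1 - s) = r ^ (n - 1) * r ^ (-((n : ℝ) + s)) := by
      rw [← Real.rpow_natCast, ← Real.rpow_add hr]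
      congr 1
      push_cast [hn]
      ring
    rw [h1]; ring
  rw [integrableOn_congr_fun (s := Ioi 0) (fun r hr => key r hr) measurableSet_Ioi]
  refine Integrable.const_mul ?_ _
  have hU : Ioi (0 : ℝ) = Ioc 0 1 ∪ Ioi 1 := (Ioc_union_Ioi_eq_Ioi zero_le_one).symm
  change IntegrableOn (fun r : ℝ => min 1 r * r ^ (-1 - s)) (Ioi 0) volume
  rw [hU]
  refine IntegrableOn.union ?_ ?_
  · have h := (intervalIntegral.integrableOn_Ioo_rpow_iff (s := -s) zero_lt_one).2
      (by linarith [hs.2])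
    rw [← integrableOn_Ioc_iff_integrableOn_Ioo] at h
    refine h.congr_fun (fun r hr => ?_) measurableSet_Ioc
    simp only
    rw [min_eq_right hr.2, ← Real.rpow_one_add' hr.1.le (by linarith [hs.1])]
    congr 1; ring
  · have h := integrableOn_Ioi_rpow_of_lt (a := -1 - s) (by linarith [hs.1]) zero_lt_one
    refine h.congr_fun (fun r hr => ?_) measurableSet_Ioi
    simp only
    rw [min_eq_left (le_of_lt hr), one_mul]

lemma measurePreserving_neg_jumpMeasure :
    MeasurePreserving (fun z : Rn n => -z) (jumpMeasure n s) (jumpMeasure n s) := by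
  refine ⟨measurable_neg, ?_⟩
  ext A hA
  rw [Measure.map_apply measurable_neg hA]
  unfold jumpMeasure
  rw [withDensity_apply _ hA, withDensity_apply _ (measurable_neg hA),
    ← (Measure.measurePreserving_neg volume).setLIntegral_comp_preimage hA
      measurable_fracKer_zero.ennreal_ofReal]
  simp [fracKer]

/-- The measure `α_{n,s} |z|^{-(n+s)} dx dz` on pairs (base point, jump). -/
abbrev pairMeasure (n : ℕ) (s : ℝ) : Measure (Rn n × Rn n) := volume.prod (jumpMeasure n s)

/-- The involution exchanging the two endpoints `x` and `x + z` of a jump. -/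
def reflectEquiv (n : ℕ) : (Rn n × Rn n) ≃ᵐ (Rn n × Rn n) where
  toFun p := (p.1 + p.2, -p.2)
  invFun p := (p.1 + p.2, -p.2)
  left_inv p := by simp
  right_inv p := by simp
  measurable_toFun := by
    change Measurable fun p : Rn n × Rn n => (p.1 + p.2, -p.2)
    fun_prop
  measurable_invFun := by
    change Measurable fun p : Rn n × Rn n => (p.1 + p.2, -p.2)
    fun_prop

lemma measurePreserving_reflectEquiv :
    MeasurePreserving (reflectEquiv n) (pairMeasure n s) (pairMeasure n s) :=
  ((MeasurePreserving.id volume).prod measurePreserving_neg_jumpMeasure).comp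
    (measurePreserving_add_prod volume (jumpMeasure n s))

lemma integral_reflect (H : Rn n → Rn n → ℝ) :
    ∫ p, H (p.1 + p.2) p.1 ∂pairMeasure n s = ∫ p, H p.1 (p.1 + p.2) ∂pairMeasure n s := by
  have := measurePreserving_reflectEquiv (n := n) (s := s) |>.integral_comp'
    (fun p => H p.1 (p.1 + p.2))
  rw [← this]
  simp [reflectEquiv]

lemma integrable_reflect {H : Rn n → Rn n → ℝ}
    (h : Integrable (fun p => H p.1 (p.1 + p.2)) (pairMeasure n s)) :
    Integrable (fun p => H (p.1 + p.2) p.1) (pairMeasure n s) := by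
  have := (measurePreserving_reflectEquiv (n := n) (s := s)).integrable_comp_of_integrable h
  refine this.congr (ae_of_all _ fun p => ?_)
  simp [reflectEquiv]

lemma pairMeasure_eq : pairMeasure n s =
    (volume.prod volume).withDensity fun p => ENNReal.ofReal (fracKer n s p.2 0) := by
  unfold pairMeasure jumpMeasure
  exact prod_withDensity_right measurable_fracKer_zero.ennreal_ofReal

lemma integrable_pairMeasure_iff (hs : s ∈ Ioo (0 : ℝ) 1) {H : Rn n → Rn n → ℝ} :
    Integrable (fun p => H p.1 (p.1 + p.2)) (pairMeasure n s) ↔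
      Integrable (fun p : Rn n × Rn n => H p.1 p.2 * fracKer n s p.1 p.2) := by
  have hm : Measurable fun p : Rn n × Rn n => ENNReal.ofReal (fracKer n s p.2 0) :=
    (measurable_fracKer_zero.comp measurable_snd).ennreal_ofReal
  have h := (measurePreserving_prod_add (volume : Measure (Rn n)) volume).integrable_comp_emb
    (MeasurableEquiv.shearAddRight (Rn n)).measurableEmbedding
    (g := fun p : Rn n × Rn n => H p.1 p.2 * fracKer n s p.1 p.2)
  rw [Measure.volume_eq_prod, ← h, pairMeasure_eq,
    integrable_withDensity_iff_integrable_smul' hm (by simp)]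
  refine integrable_congr (ae_of_all _ fun p => ?_)
  simp [ENNReal.toReal_ofReal (fracKer_nonneg hs _ _), fracKer_add_right, mul_comm]

lemma integral_pairMeasure (hs : s ∈ Ioo (0 : ℝ) 1) (H : Rn n → Rn n → ℝ) :
    ∫ p, H p.1 (p.1 + p.2) ∂pairMeasure n s =
      ∫ p : Rn n × Rn n, H p.1 p.2 * fracKer n s p.1 p.2 := by
  have hm : Measurable fun p : Rn n × Rn n => ENNReal.ofReal (fracKer n s p.2 0) :=
    (measurable_fracKer_zero.comp measurable_snd).ennreal_ofReal
  have h := (measurePreserving_prod_add (volume : Measure (Rn n)) volume).integral_comp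
    (MeasurableEquiv.shearAddRight (Rn n)).measurableEmbedding
    (fun p : Rn n × Rn n => H p.1 p.2 * fracKer n s p.1 p.2)
  rw [Measure.volume_eq_prod, ← h, pairMeasure_eq,
    integral_withDensity_eq_integral_toReal_smul hm (by simp)]
  refine integral_congr_ae (ae_of_all _ fun p => ?_)
  simp [ENNReal.toReal_ofReal (fracKer_nonneg hs _ _), fracKer_add_right, mul_comm]

lemma integral_mul_fracKer (hs : s ∈ Ioo (0 : ℝ) 1) (F : Rn n → Rn n → ℝ) (x : Rn n) :
    ∫ y, F x y * fracKer n s x y = ∫ z, F x (x + z) ∂jumpMeasure n s := by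
  rw [integral_jumpMeasure hs, ← integral_add_left_eq_self _ x]
  simp [fracKer_add_right]

lemma Qform_univ (hs : s ∈ Ioo (0 : ℝ) 1) (ε : ℝ) (u ξ : Rn n → ℝ) :
    Qform n s ε u univ ξ =
      (1 / 4) * (∫ p, (ξ p.1 - ξ (p.1 + p.2)) ^ 2 ∂pairMeasure n s) +
        ε ^ (-s) * ∫ x, (3 * u x ^ 2 - 1) * ξ x ^ 2 := by
  unfold Qform
  rw [integral_pairMeasure hs (fun x y => (ξ x - ξ y) ^ 2)]
  simp

end Kernel

section Tame

variable {n : ℕ} {s : ℝ}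

/-- Continuous functions bounded by `C` whose increments are at most `C min(1,|z|)`. -/
def BddLip (C : ℝ) (w : Rn n → ℝ) : Prop :=
  Continuous w ∧ (∀ x, |w x| ≤ C) ∧ ∀ x z, |w x - w (x + z)| ≤ C * min 1 ‖z‖

/-- Continuous functions bounded, together with their increments, by multiples of `η`. -/
def Tame (η : Rn n → ℝ) (C : ℝ) (f : Rn n → ℝ) : Prop :=
  Continuous f ∧ (∀ x, |f x| ≤ C * η x) ∧
    ∀ x z, |f x - f (x + z)| ≤ C * min 1 ‖z‖ * (η x + η (x + z))

lemma min_one_norm_nonneg (z : Rn n) : 0 ≤ min 1 ‖z‖ := le_min zero_le_one (norm_nonneg z)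

lemma BddLip.nonneg {C : ℝ} {w : Rn n → ℝ} (h : BddLip C w) : 0 ≤ C :=
  (abs_nonneg _).trans (h.2.1 0)

lemma LipschitzWith.bddLip {K : NNReal} {B : ℝ} {w : Rn n → ℝ} (h : LipschitzWith K w)
    (hB : ∀ x, |w x| ≤ B) : BddLip (max (K : ℝ) (2 * B)) w := by
  have hB0 : 0 ≤ B := (abs_nonneg _).trans (hB 0)
  refine ⟨h.continuous, fun x => (hB x).trans ((by linarith : B ≤ 2 * B).trans (le_max_right _ _)),
    fun x z => ?_⟩
  rcases le_total 1 ‖z‖ with hz | hz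
  · rw [min_eq_left hz, mul_one]
    refine le_trans ?_ (le_max_right _ _)
    calc |w x - w (x + z)| ≤ |w x| + |w (x + z)| := abs_sub _ _
      _ ≤ 2 * B := by linarith [hB x, hB (x + z)]
  · rw [min_eq_right hz]
    have := h.dist_le_mul x (x + z)
    rw [Real.dist_eq, dist_self_add_right] at this
    exact this.trans (mul_le_mul_of_nonneg_right (le_max_left _ _) (norm_nonneg _))

lemma BddLip.mul {C D : ℝ} {v w : Rn n → ℝ} (hv : BddLip C v) (hw : BddLip D w) :
    BddLip (2 * (C * D)) fun x => v x * w x := by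
  have hC := hv.nonneg
  have hD := hw.nonneg
  refine ⟨hv.1.mul hw.1, fun x => ?_, fun x z => ?_⟩
  · rw [abs_mul]
    have := mul_le_mul (hv.2.1 x) (hw.2.1 x) (abs_nonneg _) hC
    have := mul_nonneg hC hD
    linarith
  · have e : v x * w x - v (x + z) * w (x + z) =
        v x * (w x - w (x + z)) + (v x - v (x + z)) * w (x + z) := by ring
    have h1 := mul_le_mul (hv.2.1 x) (hw.2.2 x z) (abs_nonneg _) hC
    have h2 := mul_le_mul (hv.2.2 x z) (hw.2.1 (x + z)) (abs_nonneg _)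
      (mul_nonneg hC (min_one_norm_nonneg z))
    rw [e]
    refine (abs_add_le _ _).trans ?_
    rw [abs_mul, abs_mul]
    linarith

lemma Tame.mul {η : Rn n → ℝ} (hη : ∀ x, 0 < η x) {C D : ℝ} {f w : Rn n → ℝ}
    (hf : Tame η C f) (hw : BddLip D w) : Tame η (2 * (C * D)) fun x => f x * w x := by
  have hD := hw.nonneg
  have hC : 0 ≤ C := by
    have := (abs_nonneg _).trans (hf.2.1 0)
    exact nonneg_of_mul_nonneg_left this (hη 0)
  refine ⟨hf.1.mul hw.1, fun x => ?_, fun x z => ?_⟩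
  · rw [abs_mul]
    have := mul_le_mul (hf.2.1 x) (hw.2.1 x) (abs_nonneg _) (mul_nonneg hC (hη x).le)
    have := mul_nonneg (mul_nonneg hC hD) (hη x).le
    linarith
  · have e : f x * w x - f (x + z) * w (x + z) =
        f x * (w x - w (x + z)) + (f x - f (x + z)) * w (x + z) := by ring
    have hm := min_one_norm_nonneg z
    have h1 := mul_le_mul (hf.2.1 x) (hw.2.2 x z) (abs_nonneg _) (mul_nonneg hC (hη x).le)
    have h2 := mul_le_mul (hf.2.2 x z) (hw.2.1 (x + z)) (abs_nonneg _)
      (mul_nonneg (mul_nonneg hC hm) (add_pos (hη x) (hη _)).le)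
    have h3 : 0 ≤ C * D * min 1 ‖z‖ * η (x + z) :=
      mul_nonneg (mul_nonneg (mul_nonneg hC hD) hm) (hη _).le
    rw [e]
    refine (abs_add_le _ _).trans ?_
    rw [abs_mul, abs_mul]
    linarith

lemma Tame.integrable_sq {η : Rn n → ℝ} (hηi : Integrable fun x => η x ^ 2) {C : ℝ} {f : Rn n → ℝ}
    (hf : Tame η C f) : Integrable fun x => f x ^ 2 := by
  refine (hηi.const_mul (C ^ 2)).mono' (hf.1.pow 2).aestronglyMeasurable (ae_of_all _ fun x => ?_)
  rw [Real.norm_eq_abs, abs_pow, ← mul_pow]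
  exact pow_le_pow_left₀ (abs_nonneg _) (hf.2.1 x) 2


lemma integrable_left_mul_min (hn : 1 ≤ n) (hs : s ∈ Ioo (0 : ℝ) 1) {b : Rn n → ℝ}
    (hb : Integrable b) :
    Integrable (fun p : Rn n × Rn n => b p.1 * min 1 ‖p.2‖) (pairMeasure n s) :=
  hb.mul_prod (integrable_min_one_norm hn hs)

lemma integrable_right_mul_min (hn : 1 ≤ n) (hs : s ∈ Ioo (0 : ℝ) 1) {b : Rn n → ℝ}
    (hb : Integrable b) :
    Integrable (fun p : Rn n × Rn n => b (p.1 + p.2) * min 1 ‖p.2‖) (pairMeasure n s) := by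
  have h := integrable_left_mul_min hn hs hb
  have := integrable_reflect (n := n) (s := s) (H := fun x y => b x * min 1 ‖y - x‖)
    (by simpa using h)
  simpa using this

lemma integrable_pair_of_bound (hn : 1 ≤ n) (hs : s ∈ Ioo (0 : ℝ) 1) {b : Rn n → ℝ}
    (hb : Integrable b) {H : Rn n → Rn n → ℝ} (hH : Continuous fun p : Rn n × Rn n => H p.1 p.2)
    (hle : ∀ x z, |H x (x + z)| ≤ (b x + b (x + z)) * min 1 ‖z‖) :
    Integrable (fun p => H p.1 (p.1 + p.2)) (pairMeasure n s) := by
  refine ((integrable_left_mul_min hn hs hb).add (integrable_right_mul_min hn hs hb)).mono' ?_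
    (ae_of_all _ fun p => ?_)
  · exact (hH.comp (continuous_fst.prodMk (continuous_fst.add continuous_snd))).aestronglyMeasurable
  · simp only [Pi.add_apply]
    rw [Real.norm_eq_abs, ← add_mul]
    exact hle _ _

lemma Tame.sq_sub_le {η : Rn n → ℝ} {C : ℝ} {f : Rn n → ℝ} (hf : Tame η C f) (x z : Rn n) :
    (f x - f (x + z)) ^ 2 ≤
      (2 * C ^ 2 * η x ^ 2 + 2 * C ^ 2 * η (x + z) ^ 2) * min 1 ‖z‖ := by
  have h := pow_le_pow_left₀ (abs_nonneg _) (hf.2.2 x z) 2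
  rw [sq_abs] at h
  refine h.trans ?_
  have hm := min_one_norm_nonneg z
  have hm1 : min 1 ‖z‖ ≤ 1 := min_le_left _ _
  have hm2 : min 1 ‖z‖ ^ 2 ≤ min 1 ‖z‖ := by nlinarith
  have e : (C * min 1 ‖z‖ * (η x + η (x + z))) ^ 2 =
    (C ^ 2 * (η x + η (x + z)) ^ 2) * min 1 ‖z‖ ^ 2 := by ring
  rw [e]
  refine mul_le_mul ?_ hm2 (by positivity) (by positivity)
  nlinarith [mul_nonneg (sq_nonneg C) (sq_nonneg (η x - η (x + z)))]

lemma Tame.integrable_sq_sub (hn : 1 ≤ n) (hs : s ∈ Ioo (0 : ℝ) 1) {η : Rn n → ℝ}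
    (hηi : Integrable fun x => η x ^ 2) {C : ℝ} {f : Rn n → ℝ} (hf : Tame η C f) :
    Integrable (fun p => (f p.1 - f (p.1 + p.2)) ^ 2) (pairMeasure n s) := by
  have hc := hf.1
  refine integrable_pair_of_bound hn hs (hηi.const_mul (2 * C ^ 2))
    (H := fun x y => (f x - f y) ^ 2) (by fun_prop) fun x z => ?_
  rw [abs_of_nonneg (sq_nonneg _)]
  exact hf.sq_sub_le x z

/-- The operator `w ↦ ∫ (w(x) - w(x+z)) α_{n,s} |z|^{-(n+s)} dz`. -/
def jumpOp (n : ℕ) (s : ℝ) (w : Rn n → ℝ) (x : Rn n) : ℝ :=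
  ∫ z, (w x - w (x + z)) ∂jumpMeasure n s

lemma BddLip.integrable_sub (hn : 1 ≤ n) (hs : s ∈ Ioo (0 : ℝ) 1) {C : ℝ} {w : Rn n → ℝ}
    (hw : BddLip C w) (x : Rn n) : Integrable (fun z => w x - w (x + z)) (jumpMeasure n s) := by
  have hc := hw.1
  refine ((integrable_min_one_norm hn hs).const_mul C).mono'
    (Continuous.aestronglyMeasurable (by fun_prop)) (ae_of_all _ fun z => ?_)
  exact hw.2.2 x z

lemma BddLip.integrable_sub_mul (hn : 1 ≤ n) (hs : s ∈ Ioo (0 : ℝ) 1) {C : ℝ} {w g : Rn n → ℝ}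
    (hw : BddLip C w) (hgc : Continuous g) (hg : Integrable g) :
    Integrable (fun p => (w p.1 - w (p.1 + p.2)) * g p.1) (pairMeasure n s) := by
  have hc := hw.1
  refine ((integrable_left_mul_min hn hs (hg.abs.const_mul C))).mono'
    (Continuous.aestronglyMeasurable (by fun_prop)) (ae_of_all _ fun p => ?_)
  rw [norm_mul, Real.norm_eq_abs, Real.norm_eq_abs]
  have := mul_le_mul_of_nonneg_right (hw.2.2 p.1 p.2) (abs_nonneg (g p.1))
  linarith

lemma BddLip.integrable_sub_mul_sub (hn : 1 ≤ n) (hs : s ∈ Ioo (0 : ℝ) 1) {C : ℝ}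
    {w g : Rn n → ℝ} (hw : BddLip C w) (hgc : Continuous g) (hg : Integrable g) :
    Integrable (fun p => (w p.1 - w (p.1 + p.2)) * (g p.1 - g (p.1 + p.2))) (pairMeasure n s) := by
  have h1 := hw.integrable_sub_mul hn hs hgc hg
  have h2 := integrable_reflect (H := fun x y => (w x - w y) * g x) h1
  refine (h1.add h2).congr (ae_of_all _ fun p => ?_)
  simp only [Pi.add_apply]
  ring

lemma BddLip.integral_sub_mul_sub (hn : 1 ≤ n) (hs : s ∈ Ioo (0 : ℝ) 1) {C : ℝ} {w g : Rn n → ℝ}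
    (hw : BddLip C w) (hgc : Continuous g) (hg : Integrable g) :
    ∫ p, (w p.1 - w (p.1 + p.2)) * (g p.1 - g (p.1 + p.2)) ∂pairMeasure n s =
      2 * ∫ x, g x * jumpOp n s w x := by
  have h1 := hw.integrable_sub_mul hn hs hgc hg
  have h2 := integrable_reflect (H := fun x y => (w x - w y) * g x) h1
  have h3 := integral_reflect (n := n) (s := s) (H := fun x y => (w x - w y) * g x)
  have e : ∀ p : Rn n × Rn n, (w p.1 - w (p.1 + p.2)) * (g p.1 - g (p.1 + p.2)) =
      (w p.1 - w (p.1 + p.2)) * g p.1 + (w (p.1 + p.2) - w p.1) * g (p.1 + p.2) := fun p => by ring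
  simp only [e]
  rw [integral_add h1 h2, h3, integral_prod _ h1]
  simp only [integral_mul_const, jumpOp]
  rw [two_mul]
  simp only [mul_comm]

lemma BddLip.integrable_sq_mul (hn : 1 ≤ n) (hs : s ∈ Ioo (0 : ℝ) 1) {C : ℝ} {a φ : Rn n → ℝ}
    (ha : BddLip C a) (hφc : Continuous φ) (hφ : Integrable fun x => φ x ^ 2) :
    Integrable (fun p => φ p.1 ^ 2 * (a p.1 - a (p.1 + p.2)) ^ 2) (pairMeasure n s) := by
  have hc := ha.1
  refine (integrable_left_mul_min hn hs (hφ.const_mul (C ^ 2))).mono'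
    (Continuous.aestronglyMeasurable (by fun_prop)) (ae_of_all _ fun p => ?_)
  have h := pow_le_pow_left₀ (abs_nonneg _) (ha.2.2 p.1 p.2) 2
  rw [sq_abs] at h
  have hm := min_one_norm_nonneg p.2
  have hm1 : min 1 ‖p.2‖ ≤ 1 := min_le_left _ _
  have hm2 : min 1 ‖p.2‖ ^ 2 ≤ min 1 ‖p.2‖ := by nlinarith
  rw [Real.norm_eq_abs, abs_of_nonneg (by positivity)]
  calc φ p.1 ^ 2 * (a p.1 - a (p.1 + p.2)) ^ 2
      ≤ φ p.1 ^ 2 * (C * min 1 ‖p.2‖) ^ 2 := by gcongr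
    _ = C ^ 2 * φ p.1 ^ 2 * min 1 ‖p.2‖ ^ 2 := by ring
    _ ≤ C ^ 2 * φ p.1 ^ 2 * min 1 ‖p.2‖ := by gcongr

lemma BddLip.integral_sq_mul_le (hn : 1 ≤ n) (hs : s ∈ Ioo (0 : ℝ) 1) {C : ℝ} {a φ : Rn n → ℝ}
    (ha : BddLip C a) (hφc : Continuous φ) (hφ : Integrable fun x => φ x ^ 2) :
    ∫ p, φ p.1 ^ 2 * (a p.1 - a (p.1 + p.2)) ^ 2 ∂pairMeasure n s ≤
      C ^ 2 * (∫ z, min 1 ‖z‖ ∂jumpMeasure n s) * ∫ x, φ x ^ 2 := by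
  have e : C ^ 2 * (∫ z, min 1 ‖z‖ ∂jumpMeasure n s) * ∫ x, φ x ^ 2 =
      ∫ p : Rn n × Rn n, (C ^ 2 * φ p.1 ^ 2) * min 1 ‖p.2‖ ∂pairMeasure n s := by
    rw [integral_prod_mul (fun x => C ^ 2 * φ x ^ 2) (fun z => min 1 ‖z‖), integral_const_mul]
    ring
  rw [e]
  refine integral_mono (ha.integrable_sq_mul hn hs hφc hφ)
    (integrable_left_mul_min hn hs (hφ.const_mul (C ^ 2))) fun p => ?_
  have h := pow_le_pow_left₀ (abs_nonneg _) (ha.2.2 p.1 p.2) 2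
  rw [sq_abs] at h
  have hm := min_one_norm_nonneg p.2
  have hm1 : min 1 ‖p.2‖ ≤ 1 := min_le_left _ _
  have hm2 : min 1 ‖p.2‖ ^ 2 ≤ min 1 ‖p.2‖ := by nlinarith
  calc φ p.1 ^ 2 * (a p.1 - a (p.1 + p.2)) ^ 2
      ≤ φ p.1 ^ 2 * (C * min 1 ‖p.2‖) ^ 2 := by gcongr
    _ = C ^ 2 * φ p.1 ^ 2 * min 1 ‖p.2‖ ^ 2 := by ring
    _ ≤ C ^ 2 * φ p.1 ^ 2 * min 1 ‖p.2‖ := by gcongr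

end Tame

section Weight

variable {n : ℕ} {s : ℝ}

/-- The Japanese bracket `(1 + |x|²)^{1/2}`. -/
def bracket (x : Rn n) : ℝ := √(1 + ‖x‖ ^ 2)

lemma one_le_bracket (x : Rn n) : 1 ≤ bracket x :=
  Real.one_le_sqrt.2 (by nlinarith [sq_nonneg ‖x‖])

lemma bracket_pos (x : Rn n) : 0 < bracket x := zero_lt_one.trans_le (one_le_bracket x)

lemma bracket_sq (x : Rn n) : bracket x ^ 2 = 1 + ‖x‖ ^ 2 := Real.sq_sqrt (by positivity)

lemma bracket_add_le (x z : Rn n) : bracket (x + z) ≤ bracket x + ‖z‖ := by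
  have h1 := norm_add_le x z
  have h2 : ‖x‖ ≤ bracket x := Real.le_sqrt_of_sq_le (by linarith)
  refine abs_le_of_sq_le_sq' ?_ (add_nonneg (bracket_pos x).le (norm_nonneg z)) |>.2
  rw [bracket_sq]
  have h3 := pow_le_pow_left₀ (norm_nonneg _) h1 2
  nlinarith [bracket_sq x, norm_nonneg z, mul_le_mul_of_nonneg_right h2 (norm_nonneg z)]

lemma bracket_le_add (x z : Rn n) : bracket x ≤ bracket (x + z) + ‖z‖ := by
  simpa using bracket_add_le (x + z) (-z)

lemma rpow_neg_sub_le {a b t p : ℝ} (ha : 0 < a) (hb : 0 < b) (ht : 0 ≤ t) (ht1 : t ≤ 1)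
    (hp : 0 ≤ p) (hab : a ≤ b * (1 + t)) (hba : b ≤ a * (1 + t)) :
    |a ^ (-p) - b ^ (-p)| ≤ p * Real.exp p * t * a ^ (-p) := by
  have hap : 0 < a ^ (-p) := Real.rpow_pos_of_pos ha _
  have hbp : 0 < b ^ (-p) := Real.rpow_pos_of_pos hb _
  have ht1' : (1 + t) ^ p ≤ Real.exp (t * p) := by
    rw [Real.exp_mul]
    exact Real.rpow_le_rpow (by linarith) (by linarith [Real.add_one_le_exp t]) hp
  have key : ∀ {c d : ℝ}, 0 < c → 0 < d → c ≤ d * (1 + t) →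
      d ^ (-p) ≤ Real.exp (t * p) * c ^ (-p) := by
    intro c d hc hd hcd
    have h1 : c ^ p ≤ d ^ p * (1 + t) ^ p := by
      rw [← Real.mul_rpow hd.le (by linarith)]
      exact Real.rpow_le_rpow hc.le hcd hp
    have h2 : c ^ p ≤ d ^ p * Real.exp (t * p) :=
      h1.trans (mul_le_mul_of_nonneg_left ht1' (Real.rpow_nonneg hd.le _))
    rw [Real.rpow_neg hc.le, Real.rpow_neg hd.le]
    have hcp : 0 < c ^ p := Real.rpow_pos_of_pos hc _
    have hdp : 0 < d ^ p := Real.rpow_pos_of_pos hd _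
    rw [inv_eq_one_div, ← div_eq_mul_inv, div_le_div_iff₀ hdp hcp]
    linarith
  have h1 := key ha hb hab
  have h2 := key hb ha hba
  have hx : 0 ≤ t * p := mul_nonneg ht hp
  have hE : 0 < Real.exp (t * p) := Real.exp_pos _
  have hinv : Real.exp (-(t * p)) * Real.exp (t * p) = 1 := by
    rw [← Real.exp_add]; simp
  have h3 : Real.exp (t * p) - 1 ≤ t * p * Real.exp p := by
    have h4 := Real.add_one_le_exp (-(t * p))
    have h5 : Real.exp (t * p) ≤ Real.exp p := Real.exp_le_exp.2 (by nlinarith)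
    have h6 := mul_le_mul_of_nonneg_right h4 hE.le
    have h7 := mul_le_mul_of_nonneg_left h5 hx
    nlinarith
  have h8 : 1 - t * p ≤ Real.exp (-(t * p)) := by linarith [Real.add_one_le_exp (-(t * p))]
  have h9 : Real.exp (-(t * p)) * a ^ (-p) ≤ b ^ (-p) := by
    have := mul_le_mul_of_nonneg_left h2 (Real.exp_pos (-(t * p))).le
    rwa [← mul_assoc, hinv, one_mul] at this
  have h10 : 1 ≤ Real.exp p := Real.one_le_exp hp
  rw [abs_le]
  constructor
  · nlinarith [mul_le_mul_of_nonneg_right h3 hap.le]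
  · have := mul_le_mul_of_nonneg_right h8 hap.le
    have h11 := mul_le_mul_of_nonneg_left h10 (mul_nonneg hx hap.le)
    nlinarith

lemma rpow_neg_mul_rpow_neg_le {a b t q : ℝ} (ha : 0 < a) (hb : 0 < b) (ht : 0 < t)
    (hq : 0 ≤ q) (h : a ≤ b + t) :
    b ^ (-q) * t ^ (-q) ≤ 2 ^ q * a ^ (-q) * (t ^ (-q) + b ^ (-q)) := by
  have h1 : a ^ q ≤ 2 ^ q * (b ^ q + t ^ q) := by
    have hm : a ≤ 2 * max b t := by
      have := le_max_left b t
      have := le_max_right b t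
      linarith
    have hm0 : 0 ≤ max b t := hb.le.trans (le_max_left _ _)
    calc a ^ q ≤ (2 * max b t) ^ q := Real.rpow_le_rpow ha.le hm hq
      _ = 2 ^ q * max b t ^ q := Real.mul_rpow zero_le_two hm0
      _ ≤ 2 ^ q * (b ^ q + t ^ q) := by
        have h1 : 0 ≤ b ^ q := Real.rpow_nonneg hb.le _
        have h2 : 0 ≤ t ^ q := Real.rpow_nonneg ht.le _
        refine mul_le_mul_of_nonneg_left ?_ (by positivity)
        rcases max_choice b t with h | h <;> rw [h] <;> linarith
  have hap : 0 < a ^ q := Real.rpow_pos_of_pos ha _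
  have hbp : 0 < b ^ q := Real.rpow_pos_of_pos hb _
  have htp : 0 < t ^ q := Real.rpow_pos_of_pos ht _
  rw [Real.rpow_neg ha.le, Real.rpow_neg hb.le, Real.rpow_neg ht.le]
  have e : 2 ^ q * (a ^ q)⁻¹ * ((t ^ q)⁻¹ + (b ^ q)⁻¹) =
      (2 ^ q * (b ^ q + t ^ q)) * (a ^ q)⁻¹ * ((b ^ q)⁻¹ * (t ^ q)⁻¹) := by
    field_simp
  rw [e]
  have h2 : 1 ≤ (2 ^ q * (b ^ q + t ^ q)) * (a ^ q)⁻¹ := by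
    rw [← div_eq_mul_inv, one_le_div hap]
    exact h1
  have h3 : 0 ≤ (b ^ q)⁻¹ * (t ^ q)⁻¹ := by positivity
  nlinarith

/-- The weight `(1 + |x|²)^{-(n+s)/4}`. -/
def weight (n : ℕ) (s : ℝ) (x : Rn n) : ℝ := bracket x ^ (-(((n : ℝ) + s) / 2))

lemma weight_pos (x : Rn n) : 0 < weight n s x := Real.rpow_pos_of_pos (bracket_pos x) _

lemma contDiff_weight : ContDiff ℝ 1 (weight n s) := by
  unfold weight bracket
  refine ContDiff.rpow_const_of_ne (ContDiff.sqrt ?_ fun x => ?_) fun x => ?_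
  · exact contDiff_const.add (contDiff_norm_sq ℝ)
  · positivity
  · exact (bracket_pos x).ne'

lemma weight_sq (x : Rn n) : weight n s x ^ 2 = bracket x ^ (-((n : ℝ) + s)) := by
  unfold weight
  rw [← Real.rpow_natCast, ← Real.rpow_mul (bracket_pos x).le]
  congr 1
  push_cast
  ring

lemma integrable_weight_sq (hs : s ∈ Ioo (0 : ℝ) 1) :
    Integrable fun x : Rn n => weight n s x ^ 2 := by
  have h := integrable_rpow_neg_one_add_norm_sq (E := Rn n) (μ := volume) (r := (n : ℝ) + s)
    (by simpa using hs.1)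
  refine h.congr (ae_of_all _ fun x => ?_)
  simp only
  rw [weight_sq, bracket, Real.sqrt_eq_rpow, ← Real.rpow_mul (by positivity)]
  congr 1
  ring

lemma weight_sub_le (hs : s ∈ Ioo (0 : ℝ) 1) (x z : Rn n) (hz : ‖z‖ ≤ 1) :
    |weight n s x - weight n s (x + z)| ≤
      ((n + s) / 2) * Real.exp ((n + s) / 2) * ‖z‖ * weight n s x := by
  have h0 := hs.1
  refine rpow_neg_sub_le (bracket_pos x) (bracket_pos _) (norm_nonneg z) hz (by positivity) ?_ ?_
  · nlinarith [bracket_le_add x z, one_le_bracket (x + z), norm_nonneg z]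
  · nlinarith [bracket_add_le x z, one_le_bracket x, norm_nonneg z]

lemma exists_weight_sub_le (hs : s ∈ Ioo (0 : ℝ) 1) :
    ∃ C : ℝ, 0 ≤ C ∧ ∀ x z : Rn n, |weight n s x - weight n s (x + z)| ≤
      C * min 1 ‖z‖ * (weight n s x + weight n s (x + z)) := by
  have h0 := hs.1
  refine ⟨((n + s) / 2) * Real.exp ((n + s) / 2) + 1, by positivity, fun x z => ?_⟩
  set A := ((n + s) / 2) * Real.exp ((n + s) / 2) with hA_def
  have hA : 0 ≤ A := by positivity
  have h1 := weight_pos (s := s) x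
  have h2 := weight_pos (s := s) (x + z)
  rcases le_total ‖z‖ 1 with hz | hz
  · rw [min_eq_right hz]
    have hw := weight_sub_le hs x z hz
    rw [← hA_def] at hw
    refine hw.trans ?_
    have : 0 ≤ ‖z‖ * weight n s x := by positivity
    have : 0 ≤ (A + 1) * ‖z‖ * weight n s (x + z) := by positivity
    nlinarith
  · rw [min_eq_left hz]
    have : |weight n s x - weight n s (x + z)| ≤ weight n s x + weight n s (x + z) := by
      rw [abs_le]; constructor <;> linarith
    nlinarith [mul_nonneg hA (add_pos h1 h2).le]

lemma sq_weight_sub_mul_fracKer_le (hs : s ∈ Ioo (0 : ℝ) 1) (x z : Rn n) :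
    (weight n s x - weight n s (x + z)) ^ 2 * fracKer n s z 0 ≤
      weight n s x ^ 2 *
        (((((n + s) / 2) * Real.exp ((n + s) / 2)) ^ 2 + 1 + 2 ^ ((n : ℝ) + s)) *
            (min 1 ‖z‖ * fracKer n s z 0) +
          2 ^ ((n : ℝ) + s) * alphaC n s * weight n s (x + z) ^ 2) := by
  have h0 := hs.1
  set A := ((n + s) / 2) * Real.exp ((n + s) / 2) with hA
  have h1 := weight_pos (s := s) x
  have h2 := weight_pos (s := s) (x + z)
  have hk := fracKer_nonneg hs z 0
  have hα := alphaC_pos n hs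
  have h2q : 0 < (2 : ℝ) ^ ((n : ℝ) + s) := by positivity
  rcases le_total ‖z‖ 1 with hz | hz
  · rw [min_eq_right hz]
    have h3 := pow_le_pow_left₀ (abs_nonneg _) (weight_sub_le hs x z hz) 2
    rw [sq_abs, ← hA] at h3
    have h4 : ‖z‖ ^ 2 ≤ ‖z‖ := by nlinarith [norm_nonneg z]
    calc (weight n s x - weight n s (x + z)) ^ 2 * fracKer n s z 0
        ≤ (A * ‖z‖ * weight n s x) ^ 2 * fracKer n s z 0 := by gcongr
      _ = weight n s x ^ 2 * (A ^ 2 * (‖z‖ ^ 2 * fracKer n s z 0)) := by ring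
      _ ≤ weight n s x ^ 2 * (A ^ 2 * (‖z‖ * fracKer n s z 0)) := by gcongr
      _ ≤ _ := by
        gcongr
        have : 0 ≤ ‖z‖ * fracKer n s z 0 := by positivity
        have : 0 ≤ 2 ^ ((n : ℝ) + s) * alphaC n s * weight n s (x + z) ^ 2 := by positivity
        nlinarith
  · rw [min_eq_left hz, one_mul]
    have h3 : (weight n s x - weight n s (x + z)) ^ 2 ≤
        weight n s x ^ 2 + weight n s (x + z) ^ 2 := by nlinarith
    have h4 : weight n s (x + z) ^ 2 * fracKer n s z 0 ≤
        2 ^ ((n : ℝ) + s) * weight n s x ^ 2 *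
          (fracKer n s z 0 + alphaC n s * weight n s (x + z) ^ 2) := by
      have := rpow_neg_mul_rpow_neg_le (bracket_pos x) (bracket_pos (x + z))
        (zero_lt_one.trans_le hz) (q := (n : ℝ) + s) (by positivity) (bracket_le_add x z)
      rw [weight_sq, weight_sq]
      simp only [fracKer, sub_zero]
      have := mul_le_mul_of_nonneg_left this hα.le
      nlinarith
    have h5 := mul_le_mul_of_nonneg_right h3 hk
    have h6 : 0 ≤ weight n s x ^ 2 * (A ^ 2 * fracKer n s z 0) := by positivity
    nlinarith

lemma exists_integral_sq_weight_sub_le (hn : 1 ≤ n) (hs : s ∈ Ioo (0 : ℝ) 1) :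
    ∃ C : ℝ, 0 < C ∧ ∀ x : Rn n,
      ∫ z, (weight n s x - weight n s (x + z)) ^ 2 ∂jumpMeasure n s ≤ C * weight n s x ^ 2 := by
  have h0 := hs.1
  set A := (((n + s) / 2) * Real.exp ((n + s) / 2)) ^ 2 + 1 + 2 ^ ((n : ℝ) + s)
  set B := 2 ^ ((n : ℝ) + s) * alphaC n s
  have hB : 0 ≤ B := mul_nonneg (by positivity) (alphaC_pos n hs).le
  have hA : 0 ≤ A := by positivity
  have i1 := (integrable_jumpMeasure_iff hs).1 (integrable_min_one_norm hn hs)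
  have i2 := integrable_weight_sq (n := n) hs
  refine ⟨A * (∫ z : Rn n, min 1 ‖z‖ * fracKer n s z 0) + B * (∫ z : Rn n, weight n s z ^ 2) + 1,
    ?_, fun x => ?_⟩
  · have : 0 ≤ ∫ z : Rn n, min 1 ‖z‖ * fracKer n s z 0 :=
      integral_nonneg fun z => mul_nonneg (min_one_norm_nonneg z) (fracKer_nonneg hs _ _)
    have : 0 ≤ ∫ z : Rn n, weight n s z ^ 2 := integral_nonneg fun z => sq_nonneg _
    positivity
  · rw [integral_jumpMeasure hs]
    have i3 : Integrable fun z => weight n s (x + z) ^ 2 := i2.comp_add_left x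
    have i4 : Integrable fun z => weight n s x ^ 2 * (A * (min 1 ‖z‖ * fracKer n s z 0) +
        B * weight n s (x + z) ^ 2) := ((i1.const_mul A).add (i3.const_mul B)).const_mul _
    refine (integral_mono_of_nonneg (ae_of_all _ fun z => ?_) i4
      (ae_of_all _ fun z => sq_weight_sub_mul_fracKer_le hs x z)).trans ?_
    · exact mul_nonneg (sq_nonneg _) (fracKer_nonneg hs _ _)
    · rw [integral_const_mul, integral_add (i1.const_mul A) (i3.const_mul B), integral_const_mul,
        integral_const_mul, integral_add_left_eq_self (fun z => weight n s z ^ 2) x]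
      nlinarith [sq_nonneg (weight n s x)]

lemma exists_slow_weight (hn : 1 ≤ n) (hs : s ∈ Ioo (0 : ℝ) 1) {δ : ℝ} (hδ : 0 < δ) :
    ∃ (η : Rn n → ℝ) (C : ℝ), ContDiff ℝ 1 η ∧ (∀ x, 0 < η x) ∧ Tame η C η ∧
      (Integrable fun x => η x ^ 2) ∧
      ∀ x, ∫ z, (η x - η (x + z)) ^ 2 ∂jumpMeasure n s ≤ δ * η x ^ 2 := by
  have h0 := hs.1
  obtain ⟨C, hC0, hC⟩ := exists_weight_sub_le (n := n) hs
  obtain ⟨D, hD0, hD⟩ := exists_integral_sq_weight_sub_le hn hs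
  set t : ℝ := min 1 ((δ / D) ^ (1 / s)) with ht
  have ht0 : 0 < t := lt_min zero_lt_one (Real.rpow_pos_of_pos (by positivity) _)
  have ht1 : t ≤ 1 := min_le_left _ _
  have hts : t ^ s ≤ δ / D := by
    calc t ^ s ≤ ((δ / D) ^ (1 / s)) ^ s := Real.rpow_le_rpow ht0.le (min_le_right _ _) h0.le
      _ = δ / D := by
        rw [← Real.rpow_mul (by positivity), one_div_mul_cancel h0.ne', Real.rpow_one]
  have hcd : ContDiff ℝ 1 fun x : Rn n => weight n s (t • x) :=
    contDiff_weight.comp (contDiff_const_smul t)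
  refine ⟨fun x => weight n s (t • x), max 1 C, hcd, fun x => weight_pos _,
    ⟨hcd.continuous, fun x => ?_, fun x z => ?_⟩, ?_, fun x => ?_⟩
  · rw [abs_of_pos (weight_pos _)]
    nlinarith [le_max_left 1 C, weight_pos (s := s) (t • x)]
  · simp only [smul_add]
    refine (hC _ _).trans ?_
    have h1 := weight_pos (s := s) (t • x)
    have h2 := weight_pos (s := s) (t • x + t • z)
    have h3 : ‖t • z‖ ≤ ‖z‖ := by
      rw [norm_smul, Real.norm_eq_abs, abs_of_pos ht0]
      nlinarith [norm_nonneg z]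
    gcongr
    exact le_max_right _ _
  · exact (integrable_comp_smul_iff volume _ ht0.ne').2 (integrable_weight_sq (n := n) hs)
  · have := integral_jumpMeasure_comp_smul hs
      (fun w => (weight n s (t • x) - weight n s (t • x + w)) ^ 2) ht0
    simp only [smul_add]
    rw [this]
    calc t ^ s * _ ≤ (δ / D) * (D * weight n s (t • x) ^ 2) :=
          mul_le_mul hts (hD _) (integral_nonneg fun _ => sq_nonneg _) (by positivity)
      _ = δ * weight n s (t • x) ^ 2 := by field_simp

end Weight

section Density

variable {n : ℕ} {s : ℝ}

lemma BddLip.comp_smul {C t : ℝ} {w : Rn n → ℝ} (hw : BddLip C w) (ht0 : 0 ≤ t) (ht1 : t ≤ 1) :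
    BddLip C fun x => w (t • x) := by
  have hc := hw.1
  refine ⟨by fun_prop, fun x => hw.2.1 _, fun x z => ?_⟩
  simp only [smul_add]
  refine (hw.2.2 _ _).trans (mul_le_mul_of_nonneg_left (min_le_min_left _ ?_) hw.nonneg)
  rw [norm_smul, Real.norm_eq_abs, abs_of_nonneg ht0]
  nlinarith [norm_nonneg z]

lemma exists_cutoff_seq (n : ℕ) :
    ∃ (D : ℝ) (χ : ℕ → Rn n → ℝ), (∀ N, ContDiff ℝ 1 (χ N)) ∧ (∀ N, HasCompactSupport (χ N)) ∧
      (∀ N, BddLip D (χ N)) ∧ ∀ x, Tendsto (fun N => χ N x) atTop (𝓝 1) := by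
  let b : ContDiffBump (0 : Rn n) := ⟨1, 2, zero_lt_one, one_lt_two⟩
  have hb1 : ContDiff ℝ 1 (b : Rn n → ℝ) := b.contDiff
  obtain ⟨L, hL⟩ := hb1.lipschitzWith_of_hasCompactSupport b.hasCompactSupport one_ne_zero
  have hB : BddLip (max (L : ℝ) (2 * 1)) (b : Rn n → ℝ) := hL.bddLip fun x => by
    rw [abs_of_nonneg b.nonneg]
    exact b.le_one
  have ht0 : ∀ N : ℕ, (0 : ℝ) < ((N : ℝ) + 1)⁻¹ := fun N => by positivity
  refine ⟨_, fun N x => b (((N : ℝ) + 1)⁻¹ • x), fun N => hb1.comp (contDiff_const_smul _),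
    fun N => b.hasCompactSupport.comp_smul (ht0 N).ne',
    fun N => hB.comp_smul (ht0 N).le (inv_le_one_of_one_le₀ (by simp)), fun x => ?_⟩
  refine tendsto_const_nhds.congr' ?_
  filter_upwards [eventually_ge_atTop ⌈‖x‖⌉₊] with N hN
  refine (b.one_of_mem_closedBall ?_).symm
  have h : ‖x‖ ≤ N := (Nat.le_ceil _).trans (by exact_mod_cast hN)
  rw [mem_closedBall_zero_iff, norm_smul, norm_inv, Real.norm_eq_abs,
    abs_of_pos (by positivity), inv_mul_le_iff₀ (by positivity)]
  change ‖x‖ ≤ (N + 1) * 1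
  linarith

/-- Nonnegativity of the second variation on `C_c¹` extends to tame functions. -/
lemma secondVariation_nonneg_of_tame (hn : 1 ≤ n) (hs : s ∈ Ioo (0 : ℝ) 1) {ε : ℝ} {u : Rn n → ℝ}
    (huc : Continuous u) (hu : ∀ x, |u x| ≤ 1)
    (hQ : ∀ ξ, IsCc1On n univ ξ → 0 ≤ Qform n s ε u univ ξ)
    {η : Rn n → ℝ} (hη : ∀ x, 0 < η x) (hηi : Integrable fun x => η x ^ 2) {C : ℝ} {φ : Rn n → ℝ}
    (hφ : Tame η C φ) (hφ1 : ContDiff ℝ 1 φ) :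
    0 ≤ (1 / 4) * (∫ p, (φ p.1 - φ (p.1 + p.2)) ^ 2 ∂pairMeasure n s) +
      ε ^ (-s) * ∫ x, (3 * u x ^ 2 - 1) * φ x ^ 2 := by
  obtain ⟨D, χ, hχ1, hχs, hχB, hχt⟩ := exists_cutoff_seq n
  have hT : ∀ N, Tame η (2 * (C * D)) fun x => φ x * χ N x := fun N => hφ.mul hη (hχB N)
  have hlim : ∀ x, Tendsto (fun N => φ x * χ N x) atTop (𝓝 (φ x)) := fun x => by
    simpa using (hχt x).const_mul (φ x)
  have hge : ∀ N, 0 ≤ (1 / 4) *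
      (∫ p, (φ p.1 * χ N p.1 - φ (p.1 + p.2) * χ N (p.1 + p.2)) ^ 2 ∂pairMeasure n s) +
      ε ^ (-s) * ∫ x, (3 * u x ^ 2 - 1) * (φ x * χ N x) ^ 2 := fun N => by
    have h := hQ _ ⟨hφ1.mul (hχ1 N), (hχs N).mul_left, subset_univ _⟩
    rwa [Qform_univ hs] at h
  set E := 2 * (C * D) with hE
  have h1 : Tendsto (fun N => ∫ p, (φ p.1 * χ N p.1 - φ (p.1 + p.2) * χ N (p.1 + p.2)) ^ 2
      ∂pairMeasure n s) atTop
      (𝓝 (∫ p, (φ p.1 - φ (p.1 + p.2)) ^ 2 ∂pairMeasure n s)) := by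
    refine tendsto_integral_of_dominated_convergence
      (fun p => (2 * E ^ 2 * η p.1 ^ 2) * min 1 ‖p.2‖ + (2 * E ^ 2 * η (p.1 + p.2) ^ 2) * min 1 ‖p.2‖)
      (fun N => ?_) ?_ (fun N => ae_of_all _ fun p => ?_) (ae_of_all _ fun p => ?_)
    · have h1 := hφ.1
      have h2 := (hχ1 N).continuous
      exact Continuous.aestronglyMeasurable (by fun_prop)
    · exact (integrable_left_mul_min hn hs (hηi.const_mul _)).add
        (integrable_right_mul_min hn hs (hηi.const_mul (2 * E ^ 2)))
    · rw [Real.norm_eq_abs, abs_of_nonneg (sq_nonneg _), ← add_mul]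
      exact (hT N).sq_sub_le _ _
    · exact ((hlim _).sub (hlim _)).pow 2
  have h2 : Tendsto (fun N => ∫ x, (3 * u x ^ 2 - 1) * (φ x * χ N x) ^ 2) atTop
      (𝓝 (∫ x, (3 * u x ^ 2 - 1) * φ x ^ 2)) := by
    refine tendsto_integral_of_dominated_convergence
      (fun x => 2 * (E ^ 2 * η x ^ 2))
      (fun N => ?_) ((hηi.const_mul _).const_mul 2) (fun N => ae_of_all _ fun x => ?_)
      (ae_of_all _ fun x => ?_)
    · have h1 := hφ.1
      have h2 := (hχ1 N).continuous
      exact Continuous.aestronglyMeasurable (by fun_prop)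
    · rw [norm_mul, Real.norm_eq_abs, Real.norm_eq_abs, abs_pow, ← mul_pow]
      refine mul_le_mul ?_ (pow_le_pow_left₀ (abs_nonneg _) ((hT N).2.1 x) 2) (by positivity)
        zero_le_two
      have := sq_le_one_iff_abs_le_one (u x) |>.2 (hu x)
      rw [abs_le]
      constructor <;> nlinarith [sq_nonneg (u x)]
    · exact ((hlim _).pow 2).const_mul _
  exact ge_of_tendsto' ((h1.const_mul (1 / 4)).add (h2.const_mul (ε ^ (-s)))) hge

end Density

section IntegralBounds

variable {α : Type*} [MeasurableSpace α] {μ : Measure α} {F f g h k : α → ℝ}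

lemma integral_le_of_le_add_three (hF : Integrable F μ) (hf : Integrable f μ) (hg : Integrable g μ)
    (hh : Integrable h μ) (a b c : ℝ) (hle : ∀ x, F x ≤ a * f x + b * g x + c * h x) :
    ∫ x, F x ∂μ ≤ a * (∫ x, f x ∂μ) + b * (∫ x, g x ∂μ) + c * ∫ x, h x ∂μ := by
  have hab : Integrable (fun x => a * f x + b * g x) μ := (hf.const_mul a).add (hg.const_mul b)
  refine (integral_mono hF (hab.add (hh.const_mul c)) hle).trans_eq ?_
  simp only [Pi.add_apply]
  rw [integral_add hab (hh.const_mul c), integral_add (hf.const_mul a) (hg.const_mul b)]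
  simp only [integral_const_mul]

lemma integral_le_of_le_add_four (hF : Integrable F μ) (hf : Integrable f μ) (hg : Integrable g μ)
    (hh : Integrable h μ) (hk : Integrable k μ) (a b c d : ℝ)
    (hle : ∀ x, F x ≤ a * f x + b * g x + c * h x + d * k x) :
    ∫ x, F x ∂μ ≤
      a * (∫ x, f x ∂μ) + b * (∫ x, g x ∂μ) + c * (∫ x, h x ∂μ) + d * ∫ x, k x ∂μ := by
  have hab : Integrable (fun x => a * f x + b * g x) μ := (hf.const_mul a).add (hg.const_mul b)
  have := integral_le_of_le_add_three hF hab hh hk 1 c d fun x => by simpa using hle x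
  rwa [one_mul, integral_add (hf.const_mul a) (hg.const_mul b), integral_const_mul,
    integral_const_mul] at this

end IntegralBounds

section SlowlyModulated

variable {n : ℕ} {s : ℝ}

lemma integrable_sq_mul_weight_sub (hn : 1 ≤ n) (hs : s ∈ Ioo (0 : ℝ) 1) {η : Rn n → ℝ} {C : ℝ}
    (hη : Tame η C η) (hηi : Integrable fun x => η x ^ 2) {B : ℝ} {v : Rn n → ℝ}
    (hv : BddLip B v) :
    Integrable (fun p => v p.1 ^ 2 * (η p.1 - η (p.1 + p.2)) ^ 2) (pairMeasure n s) := by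
  have h1 := hη.1
  have h2 := hv.1
  refine ((hη.integrable_sq_sub hn hs hηi).const_mul (B ^ 2)).mono'
    (Continuous.aestronglyMeasurable (by fun_prop)) (ae_of_all _ fun p => ?_)
  rw [Real.norm_eq_abs, abs_of_nonneg (by positivity)]
  refine mul_le_mul_of_nonneg_right ?_ (sq_nonneg _)
  have := pow_le_pow_left₀ (abs_nonneg _) (hv.2.1 p.1) 2
  rwa [sq_abs] at this

lemma integral_sq_mul_weight_sub_le (hn : 1 ≤ n) (hs : s ∈ Ioo (0 : ℝ) 1) {η : Rn n → ℝ} {C δ : ℝ}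
    (hη : Tame η C η) (hηi : Integrable fun x => η x ^ 2)
    (hδ : ∀ x, ∫ z, (η x - η (x + z)) ^ 2 ∂jumpMeasure n s ≤ δ * η x ^ 2) {B : ℝ} {v : Rn n → ℝ}
    (hv : BddLip B v) (hφi : Integrable fun x => (η x * v x) ^ 2) :
    ∫ p, v p.1 ^ 2 * (η p.1 - η (p.1 + p.2)) ^ 2 ∂pairMeasure n s ≤
      δ * ∫ x, (η x * v x) ^ 2 := by
  have hi := integrable_sq_mul_weight_sub hn hs hη hηi hv
  rw [integral_prod _ hi, ← integral_const_mul]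
  refine integral_mono hi.integral_prod_left (hφi.const_mul δ) fun x => ?_
  simp only [integral_const_mul]
  calc v x ^ 2 * _ ≤ v x ^ 2 * (δ * η x ^ 2) := mul_le_mul_of_nonneg_left (hδ x) (sq_nonneg _)
    _ = δ * (η x * v x) ^ 2 := by ring

lemma modulated_pointwise_le {θ : ℝ} (hθ : 0 < θ) {a₁ : ℝ} (ha : |a₁| ≤ 2)
    (a₂ v₁ v₂ η₁ η₂ : ℝ) :
    -((v₁ - v₂) * (a₁ * (η₁ ^ 2 * v₁) - a₂ * (η₂ ^ 2 * v₂))) ≤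
      (2 + 1 / θ) * (η₁ * v₁ - η₂ * v₂) ^ 2 + (1 + 1 / θ) * (v₁ ^ 2 * (η₁ - η₂) ^ 2) +
        1 * (v₂ ^ 2 * (η₂ - η₁) ^ 2) + θ * ((η₂ * v₂) ^ 2 * (a₂ - a₁) ^ 2) := by
  set d := η₁ * v₁ - η₂ * v₂ with hd
  set e := η₁ - η₂ with he
  have h0 : (v₁ - v₂) * (a₁ * (η₁ ^ 2 * v₁) - a₂ * (η₂ ^ 2 * v₂)) =
      a₁ * (d ^ 2 - v₁ * v₂ * e ^ 2) + (η₂ * v₂) * (a₁ - a₂) * (d - v₁ * e) := by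
    rw [hd, he]; ring
  have h1 : -(a₁ * (d ^ 2 - v₁ * v₂ * e ^ 2)) ≤
      2 * d ^ 2 + v₁ ^ 2 * e ^ 2 + v₂ ^ 2 * e ^ 2 := by
    obtain ⟨l, r⟩ := abs_le.1 ha
    have i1 : -a₁ * d ^ 2 ≤ 2 * d ^ 2 := mul_le_mul_of_nonneg_right (by linarith) (sq_nonneg _)
    have i2 : a₁ * (v₁ * v₂) ≤ v₁ ^ 2 + v₂ ^ 2 := by
      nlinarith [mul_nonneg (show 0 ≤ 2 - a₁ by linarith) (sq_nonneg (v₁ + v₂)),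
        mul_nonneg (show 0 ≤ 2 + a₁ by linarith) (sq_nonneg (v₁ - v₂))]
    have i3 := mul_le_mul_of_nonneg_right i2 (sq_nonneg e)
    linarith
  have h2 : -((η₂ * v₂) * (a₁ - a₂) * (d - v₁ * e)) ≤
      1 / θ * (d ^ 2 + v₁ ^ 2 * e ^ 2) + θ * ((η₂ * v₂) ^ 2 * (a₂ - a₁) ^ 2) := by
    set r := (η₂ * v₂) * (a₁ - a₂) with hr
    have h3 : (η₂ * v₂) ^ 2 * (a₂ - a₁) ^ 2 = r ^ 2 := by rw [hr]; ring
    rw [h3]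
    set t := 1 / θ with ht
    have htθ : t * θ = 1 := by rw [ht]; field_simp
    have ht0 : 0 < t := by rw [ht]; positivity
    have h4 : 0 ≤ t * (d - v₁ * e + 2 * θ * r) ^ 2 := by positivity
    have h5 : t * (d - v₁ * e + 2 * θ * r) ^ 2 = t * (d - v₁ * e) ^ 2 +
        4 * (t * θ) * r * (d - v₁ * e) + 4 * (t * θ) * θ * r ^ 2 := by ring
    rw [h5, htθ] at h4
    have h6 := mul_nonneg ht0.le (sq_nonneg (d + v₁ * e))
    have h7 := mul_nonneg ht0.le (sq_nonneg d)
    have h8 := mul_nonneg ht0.le (sq_nonneg (v₁ * e))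
    linarith
  have h6 : (η₂ - η₁) ^ 2 = e ^ 2 := by rw [he]; ring
  rw [h0, h6]
  linarith

/-- Energy estimates for `φ = η v`, where `v` solves a linearized equation and `η` varies slowly. -/
lemma modulated_energy_estimates (hn : 1 ≤ n) (hs : s ∈ Ioo (0 : ℝ) 1) {c : ℝ} (hc : 0 < c)
    {η : Rn n → ℝ} {C ρ : ℝ} (hη0 : ∀ x, 0 < η x) (hη : Tame η C η)
    (hηi : Integrable fun x => η x ^ 2)
    (hδ : ∀ x, ∫ z, (η x - η (x + z)) ^ 2 ∂jumpMeasure n s ≤ ρ * η x ^ 2)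
    {B : ℝ} {v : Rn n → ℝ} (hv : BddLip B v)
    {A : ℝ} {a : Rn n → ℝ} (ha : BddLip A a) (ha2 : ∀ x, |a x| ≤ 2)
    {q : Rn n → ℝ} (hqc : Continuous q) (hq : ∀ x, |q x - a x| ≤ 3 * ρ)
    (hLv : ∀ x, jumpOp n s v x = -(c * (q x * v x)))
    (hstab : 0 ≤ (1 / 4) *
      (∫ p, (η p.1 * v p.1 - η (p.1 + p.2) * v (p.1 + p.2)) ^ 2 ∂pairMeasure n s) +
      c * ∫ x, a x * (η x * v x) ^ 2) :
    (∫ p, (η p.1 * v p.1 - η (p.1 + p.2) * v (p.1 + p.2)) ^ 2 ∂pairMeasure n s ≤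
      (2 + 12 * c) * ρ * ∫ x, (η x * v x) ^ 2) ∧
    ∀ θ : ℝ, 0 < θ → 2 * c * ∫ x, a x ^ 2 * (η x * v x) ^ 2 ≤
      (12 * c * ρ + (2 + 1 / θ) * ((3 + 12 * c) * ρ) +
        θ * (A ^ 2 * ∫ z, min 1 ‖z‖ ∂jumpMeasure n s)) * ∫ x, (η x * v x) ^ 2 := by
  have hηc := hη.1
  have hvc := hv.1
  have hac := ha.1
  have hφ : Tame η (2 * (C * B)) fun x => η x * v x := hη.mul hη0 hv
  have hφi := hφ.integrable_sq hηi
  have hdi := hφ.integrable_sq_sub hn hs hηi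
  have hei := integrable_sq_mul_weight_sub hn hs hη hηi hv
  have hele := integral_sq_mul_weight_sub_le hn hs hη hηi hδ hv hφi
  have hei' : Integrable (fun p => v (p.1 + p.2) ^ 2 * (η (p.1 + p.2) - η p.1) ^ 2)
      (pairMeasure n s) := integrable_reflect (H := fun x y => v x ^ 2 * (η x - η y) ^ 2) hei
  have hele' : ∫ p, v (p.1 + p.2) ^ 2 * (η (p.1 + p.2) - η p.1) ^ 2 ∂pairMeasure n s ≤
      ρ * ∫ x, (η x * v x) ^ 2 :=
    (integral_reflect (n := n) (s := s) (H := fun x y => v x ^ 2 * (η x - η y) ^ 2)).trans_le hele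
  have hq2 : ∀ x, |q x| ≤ 2 + 3 * ρ := fun x => by
    have := abs_sub_abs_le_abs_sub (q x) (a x)
    linarith [hq x, ha2 x]
  have hbi : ∀ {b : Rn n → ℝ} {D : ℝ}, Continuous b → (∀ x, |b x| ≤ D) →
      Integrable fun x => b x * (η x * v x) ^ 2 := fun {b D} hb hD => by
    refine (hφi.const_mul D).mono' (Continuous.aestronglyMeasurable (by fun_prop))
      (ae_of_all _ fun x => ?_)
    rw [norm_mul, Real.norm_eq_abs, Real.norm_eq_abs, abs_of_nonneg (sq_nonneg (η x * v x))]
    exact mul_le_mul_of_nonneg_right (hD x) (sq_nonneg _)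
  have hai := hbi hac ha2
  have hqi := hbi hqc hq2
  have haai : Integrable fun x => a x ^ 2 * (η x * v x) ^ 2 := hbi (b := fun x => a x ^ 2)
    (D := 2 ^ 2) (by fun_prop) fun x => by
      rw [abs_pow]
      exact pow_le_pow_left₀ (abs_nonneg _) (ha2 x) 2
  have hqai : Integrable fun x => q x * a x * (η x * v x) ^ 2 := hbi (b := fun x => q x * a x)
    (D := (2 + 3 * ρ) * 2) (by fun_prop) fun x => by
      rw [abs_mul]
      exact mul_le_mul (hq2 x) (ha2 x) (abs_nonneg _) ((abs_nonneg _).trans (hq2 x))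
  have hgi : ∀ {b : Rn n → ℝ} {D : ℝ}, Continuous b → (∀ x, |b x| ≤ D) →
      Integrable fun x => b x * (η x ^ 2 * v x) := fun {b D} hb hD => by
    refine (hηi.const_mul (D * B)).mono' (Continuous.aestronglyMeasurable (by fun_prop))
      (ae_of_all _ fun x => ?_)
    rw [norm_mul, norm_mul, Real.norm_eq_abs, Real.norm_eq_abs, Real.norm_eq_abs,
      abs_of_nonneg (sq_nonneg (η x))]
    have h1 := mul_le_mul (hD x) (hv.2.1 x) (abs_nonneg _) ((abs_nonneg _).trans (hD x))
    have h2 := mul_le_mul_of_nonneg_right h1 (sq_nonneg (η x))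
    linarith
  set P := ∫ x, (η x * v x) ^ 2 with hP
  set I := ∫ p, (η p.1 * v p.1 - η (p.1 + p.2) * v (p.1 + p.2)) ^ 2 ∂pairMeasure n s with hI
  have hP0 : 0 ≤ P := integral_nonneg fun x => sq_nonneg _
  have hI1 : I ≤ ρ * P - 2 * c * ∫ x, q x * (η x * v x) ^ 2 := by
    have hg : Integrable fun x => η x ^ 2 * v x := by
      simpa using hgi (b := fun _ => 1) (D := 1) continuous_const (by simp)
    have hw := hv.integrable_sub_mul_sub hn hs (g := fun x => η x ^ 2 * v x) (by fun_prop) hg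
    have hw' := hv.integral_sub_mul_sub hn hs (g := fun x => η x ^ 2 * v x) (by fun_prop) hg
    have e1 : 2 * ∫ x, η x ^ 2 * v x * jumpOp n s v x =
        -(2 * c * ∫ x, q x * (η x * v x) ^ 2) := by
      have : ∀ x, η x ^ 2 * v x * jumpOp n s v x = -c * (q x * (η x * v x) ^ 2) := fun x => by
        rw [hLv]; ring
      simp only [this, integral_const_mul]
      ring
    have := integral_le_of_le_add_three hdi hei hei' hw (1 / 2) (1 / 2) 1 fun p => by
      nlinarith [mul_nonneg (sq_nonneg (v p.1 - v (p.1 + p.2)))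
        (sq_nonneg (η p.1 - η (p.1 + p.2)))]
    rw [hw', e1] at this
    linarith
  have hqa : (∫ x, a x * (η x * v x) ^ 2) - (∫ x, q x * (η x * v x) ^ 2) ≤ 3 * ρ * P := by
    rw [← integral_sub hai hqi, hP, ← integral_const_mul]
    refine integral_mono (hai.sub hqi) (hφi.const_mul _) fun x => ?_
    have := (abs_le.1 (hq x)).1
    simp only
    rw [← sub_mul]
    exact mul_le_mul_of_nonneg_right (by linarith) (sq_nonneg _)
  have hI2 : I ≤ (2 + 12 * c) * ρ * P := by
    have := mul_le_mul_of_nonneg_left hqa hc.le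
    linarith
  refine ⟨hI2, fun θ hθ => ?_⟩
  have hg := hgi hac ha2
  have hw := hv.integrable_sub_mul_sub hn hs (g := fun x => a x * (η x ^ 2 * v x)) (by fun_prop) hg
  have hw' := hv.integral_sub_mul_sub hn hs (g := fun x => a x * (η x ^ 2 * v x)) (by fun_prop) hg
  have e1 : 2 * ∫ x, a x * (η x ^ 2 * v x) * jumpOp n s v x =
      -(2 * c * ∫ x, q x * a x * (η x * v x) ^ 2) := by
    have : ∀ x, a x * (η x ^ 2 * v x) * jumpOp n s v x = -c * (q x * a x * (η x * v x) ^ 2) :=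
      fun x => by rw [hLv]; ring
    simp only [this, integral_const_mul]
    ring
  have hφa := ha.integrable_sq_mul hn hs hφ.1 hφi
  have hφa' : Integrable (fun p => (η (p.1 + p.2) * v (p.1 + p.2)) ^ 2 *
      (a (p.1 + p.2) - a p.1) ^ 2) (pairMeasure n s) :=
    integrable_reflect (H := fun x y => (η x * v x) ^ 2 * (a x - a y) ^ 2) hφa
  have hφle : ∫ p, (η (p.1 + p.2) * v (p.1 + p.2)) ^ 2 * (a (p.1 + p.2) - a p.1) ^ 2
      ∂pairMeasure n s ≤ A ^ 2 * (∫ z, min 1 ‖z‖ ∂jumpMeasure n s) * P :=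
    (integral_reflect (n := n) (s := s)
      (H := fun x y => (η x * v x) ^ 2 * (a x - a y) ^ 2)).trans_le
      (ha.integral_sq_mul_le hn hs hφ.1 hφi)
  have hint := integral_le_of_le_add_four hw.neg hdi hei hei' hφa' (2 + 1 / θ) (1 + 1 / θ) 1 θ
    fun p => modulated_pointwise_le hθ (ha2 p.1) _ _ _ _ _
  simp only [Pi.neg_apply] at hint
  rw [integral_neg, hw', e1, neg_neg] at hint
  have hqa2 : (∫ x, a x ^ 2 * (η x * v x) ^ 2) - (∫ x, q x * a x * (η x * v x) ^ 2) ≤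
      6 * ρ * P := by
    rw [← integral_sub haai hqai, hP, ← integral_const_mul]
    refine integral_mono (haai.sub hqai) (hφi.const_mul _) fun x => ?_
    simp only
    rw [← sub_mul]
    refine mul_le_mul_of_nonneg_right ?_ (sq_nonneg _)
    have h1 := mul_le_mul (hq x) (ha2 x) (abs_nonneg _) ((abs_nonneg _).trans (hq x))
    rw [← abs_mul] at h1
    have := (abs_le.1 h1).1
    nlinarith
  have h1 := mul_le_mul_of_nonneg_left hI2 (show 0 ≤ 2 + 1 / θ by positivity)
  have h2 := mul_le_mul_of_nonneg_left hele (show 0 ≤ 1 + 1 / θ by positivity)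
  have h3 := mul_le_mul_of_nonneg_left hφle hθ.le
  have h4 := mul_le_mul_of_nonneg_left hqa2 (show 0 ≤ 2 * c by positivity)
  linarith

end SlowlyModulated

section NearlyCritical

variable {n : ℕ} {s : ℝ}

lemma eq_zero_val_of_small_periods {E : Type*} [NormedAddCommGroup E] [NormedSpace ℝ E] {u : E → ℝ}
    {r : ℝ} (hr : 0 < r) (h : ∀ z : E, ‖z‖ ≤ r → ∀ x, u (x + z) = u x) (x : E) : u x = u 0 := by
  obtain ⟨N, hN⟩ := exists_nat_gt (‖x‖ / r)
  have hN0 : (0 : ℝ) < N := (div_nonneg (norm_nonneg x) hr.le).trans_lt hN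
  have hz : ‖(N : ℝ)⁻¹ • x‖ ≤ r := by
    rw [norm_smul, norm_inv, Real.norm_eq_abs, abs_of_pos hN0, inv_mul_le_iff₀ hN0]
    exact ((div_lt_iff₀ hr).1 hN).le
  have key : ∀ k : ℕ, u ((k : ℝ) • ((N : ℝ)⁻¹ • x)) = u 0 := fun k => by
    induction k with
    | zero => simp
    | succ k ih => rw [Nat.cast_succ, add_smul, one_smul, h _ hz, ih]
  have := key N
  rwa [smul_smul, mul_inv_cancel₀ hN0.ne', one_smul] at this

lemma integral_sq_pos {φ : Rn n → ℝ} (hc : Continuous φ) (hi : Integrable fun x => φ x ^ 2)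
    {x₀ : Rn n} (hx : φ x₀ ≠ 0) : 0 < ∫ x, φ x ^ 2 := by
  rw [integral_pos_iff_support_of_nonneg (fun x => sq_nonneg _) hi]
  exact (hc.pow 2).isOpen_support.measure_pos _ ⟨x₀, by simpa using hx⟩

lemma BddLip.three_sq_sub_one {C : ℝ} {u : Rn n → ℝ} (hu : BddLip C u) (hu1 : ∀ x, |u x| ≤ 1) :
    BddLip (2 + 6 * C) fun x => 3 * u x ^ 2 - 1 := by
  have hc := hu.1
  have hC := hu.nonneg
  refine ⟨by fun_prop, fun x => ?_, fun x z => ?_⟩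
  · have := (sq_le_one_iff_abs_le_one _).2 (hu1 x)
    rw [abs_le]
    constructor <;> nlinarith [sq_nonneg (u x)]
  · have e : 3 * u x ^ 2 - 1 - (3 * u (x + z) ^ 2 - 1) =
        3 * (u x + u (x + z)) * (u x - u (x + z)) := by ring
    have h1 : |3 * (u x + u (x + z))| ≤ 6 := by
      have h1 := abs_le.1 (hu1 x)
      have h2 := abs_le.1 (hu1 (x + z))
      rw [abs_le]
      constructor <;> linarith [h1.1, h1.2, h2.1, h2.2]
    rw [e, abs_mul]
    have hm := min_one_norm_nonneg z
    calc _ ≤ 6 * (C * min 1 ‖z‖) :=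
          mul_le_mul h1 (hu.2.2 x z) (abs_nonneg _) (by norm_num)
      _ ≤ (2 + 6 * C) * min 1 ‖z‖ := by linarith

/-- A nonconstant solution with nonnegative second variation carries functions of small energy
concentrated near the degenerate set of `W''(u)`. -/
lemma exists_nearly_critical (hn : 1 ≤ n) (hs : s ∈ Ioo (0 : ℝ) 1) {ε : ℝ} (hε : 0 < ε)
    {u : Rn n → ℝ} (hu1 : ∀ x, |u x| ≤ 1) {K : NNReal} (hlip : LipschitzWith K u)
    (hC1 : ContDiff ℝ 1 u) (hsol : ∀ x, jumpOp n s u x = ε ^ (-s) * (u x - u x ^ 3))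
    (hQ : ∀ ξ, IsCc1On n univ ξ → 0 ≤ Qform n s ε u univ ξ) (hnc : ¬ ∀ x, u x = u 0)
    {τ : ℝ} (hτ : 0 < τ) :
    ∃ φ : Rn n → ℝ, Continuous φ ∧ (Integrable fun x => φ x ^ 2) ∧ 0 < ∫ x, φ x ^ 2 ∧
      Integrable (fun p => (φ p.1 - φ (p.1 + p.2)) ^ 2) (pairMeasure n s) ∧
      ∫ p, (φ p.1 - φ (p.1 + p.2)) ^ 2 ∂pairMeasure n s ≤ τ * ∫ x, φ x ^ 2 ∧
      ∫ x, (3 * u x ^ 2 - 1) ^ 2 * φ x ^ 2 ≤ τ * ∫ x, φ x ^ 2 := by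
  set c := ε ^ (-s) with hc_def
  have hc : 0 < c := Real.rpow_pos_of_pos hε _
  have huB := hlip.bddLip hu1
  have haB := huB.three_sq_sub_one hu1
  set A := 2 + 6 * max (K : ℝ) (2 * 1) with hA
  set κ := ∫ z, min 1 ‖z‖ ∂jumpMeasure n s with hκ
  have hκ0 : 0 ≤ κ := integral_nonneg fun z => min_one_norm_nonneg z
  set θ := c * τ / (A ^ 2 * κ + 1) with hθ_def
  have hθ : 0 < θ := by positivity
  have hθ1 : θ * (A ^ 2 * κ) ≤ c * τ := by
    have : θ * (A ^ 2 * κ + 1) = c * τ := by rw [hθ_def]; field_simp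
    nlinarith
  set S := 12 * c + (2 + 1 / θ) * (3 + 12 * c) + c * (2 + 12 * c) with hS_def
  have hS : 0 < S := by positivity
  set ρ := τ * c / S with hρ_def
  have hρ : 0 < ρ := by positivity
  have hρS : S * ρ = τ * c := by rw [hρ_def]; field_simp
  have hρ1 : (2 + 12 * c) * ρ ≤ τ := by
    have h1 : 0 ≤ (12 * c + (2 + 1 / θ) * (3 + 12 * c)) * ρ := by positivity
    have h2 : c * ((2 + 12 * c) * ρ) ≤ c * τ := by nlinarith
    exact le_of_mul_le_mul_left h2 hc
  have hρ2 : 12 * c * ρ + (2 + 1 / θ) * ((3 + 12 * c) * ρ) ≤ c * τ := by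
    have h1 : 0 ≤ c * (2 + 12 * c) * ρ := by positivity
    nlinarith
  obtain ⟨η, C, hη1, hη0, hη, hηi, hδ⟩ := exists_slow_weight hn hs hρ
  obtain ⟨h, hh, x₀, hx₀⟩ : ∃ h : Rn n, ‖h‖ ≤ ρ / (K + 1) ∧ ∃ x, u (x + h) ≠ u x := by
    by_contra! hcon
    exact hnc fun x => eq_zero_val_of_small_periods (r := ρ / (K + 1)) (by positivity) hcon x
  set v : Rn n → ℝ := fun x => u (x + h) - u x with hv_def
  have hvρ : ∀ x, |v x| ≤ ρ := fun x => by
    have h1 := hlip.dist_le_mul (x + h) x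
    rw [Real.dist_eq, dist_eq_norm, add_sub_cancel_left] at h1
    have h2 : ‖h‖ * (K + 1) ≤ ρ := (le_div_iff₀ (by positivity)).1 hh
    refine h1.trans ?_
    nlinarith [norm_nonneg h]
  have hulip' : LipschitzWith K fun x => u (x + h) := by
    have := hlip.comp (isometry_add_right h).lipschitz
    rwa [mul_one] at this
  have hvB : BddLip _ v := (hulip'.sub hlip).bddLip hvρ
  have hv1 : ContDiff ℝ 1 v := (hC1.comp (contDiff_id.add contDiff_const)).sub hC1
  have huc := hlip.continuous
  have hφ := hη.mul hη0 hvB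
  have hLv : ∀ x, jumpOp n s v x =
      -(c * ((u (x + h) ^ 2 + u (x + h) * u x + u x ^ 2 - 1) * v x)) := fun x => by
    have e : jumpOp n s v x = jumpOp n s u (x + h) - jumpOp n s u x := by
      unfold jumpOp
      rw [← integral_sub (huB.integrable_sub hn hs _) (huB.integrable_sub hn hs _)]
      congr 1
      funext z
      simp only [hv_def]
      rw [add_right_comm x z h]
      ring
    rw [e, hsol, hsol]
    simp only [hv_def]
    ring
  have hq : ∀ x, |(u (x + h) ^ 2 + u (x + h) * u x + u x ^ 2 - 1) - (3 * u x ^ 2 - 1)| ≤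
      3 * ρ := fun x => by
    have e : (u (x + h) ^ 2 + u (x + h) * u x + u x ^ 2 - 1) - (3 * u x ^ 2 - 1) =
        (u (x + h) + 2 * u x) * v x := by simp only [hv_def]; ring
    rw [e, abs_mul]
    refine mul_le_mul ?_ (hvρ x) (abs_nonneg _) (by norm_num)
    have h1 := abs_le.1 (hu1 x)
    have h2 := abs_le.1 (hu1 (x + h))
    rw [abs_le]
    constructor <;> linarith [h1.1, h1.2, h2.1, h2.2]
  have ha2 : ∀ x, |3 * u x ^ 2 - 1| ≤ 2 := fun x => by
    have := (sq_le_one_iff_abs_le_one _).2 (hu1 x)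
    rw [abs_le]
    constructor <;> nlinarith [sq_nonneg (u x)]
  have hφi := hφ.integrable_sq hηi
  obtain ⟨hI, hW⟩ := modulated_energy_estimates hn hs hc hη0 hη hηi hδ hvB haB ha2
    (q := fun x => u (x + h) ^ 2 + u (x + h) * u x + u x ^ 2 - 1) (by fun_prop) hq hLv
    (secondVariation_nonneg_of_tame hn hs huc hu1 hQ hη0 hηi hφ (hη1.mul hv1))
  refine ⟨_, hφ.1, hφi, integral_sq_pos hφ.1 hφi (x₀ := x₀) ?_, hφ.integrable_sq_sub hn hs hηi,
    hI.trans (mul_le_mul_of_nonneg_right hρ1 (integral_nonneg fun x => sq_nonneg _)), ?_⟩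
  · exact mul_ne_zero (hη0 _).ne' (sub_ne_zero.2 hx₀)
  · have h1 := hW θ hθ
    have hP : 0 ≤ ∫ x, (η x * v x) ^ 2 := integral_nonneg fun x => sq_nonneg _
    have h2 := mul_le_mul_of_nonneg_right (add_le_add hρ2 hθ1) hP
    have h3 := h1.trans h2
    nlinarith

/-- Constant solutions are unstable. -/
lemma not_stable_of_const (hn : 1 ≤ n) (hs : s ∈ Ioo (0 : ℝ) 1) {ε : ℝ} (hε : 0 < ε)
    {u : Rn n → ℝ} (hu1 : ∀ x, |u x| < 1) (huc : Continuous u)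
    (hsol : ∀ x, jumpOp n s u x = ε ^ (-s) * (u x - u x ^ 3))
    (hQ : ∀ ξ, IsCc1On n univ ξ → 0 ≤ Qform n s ε u univ ξ) (hconst : ∀ x, u x = u 0) : False := by
  have hc : 0 < ε ^ (-s) := Real.rpow_pos_of_pos hε _
  have h0 : u 0 = 0 := by
    have h1 := hsol 0
    have h2 : jumpOp n s u 0 = 0 := by
      unfold jumpOp
      simp [hconst]
    rw [h2] at h1
    have h3 : u 0 * (1 - u 0 ^ 2) = 0 := by
      have := (mul_eq_zero.1 h1.symm).resolve_left hc.ne'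
      linarith
    refine (mul_eq_zero.1 h3).resolve_right ?_
    have := (sq_lt_one_iff_abs_lt_one _).2 (hu1 0)
    linarith
  obtain ⟨η, C, hη1, hη0, hη, hηi, hδ⟩ := exists_slow_weight hn hs hc
  have h1 := secondVariation_nonneg_of_tame hn hs huc (fun x => (hu1 x).le) hQ hη0 hηi hη hη1
  have hpos := integral_sq_pos hη.1 hηi (hη0 0).ne'
  have hi := hη.integrable_sq_sub hn hs hηi
  have h2 : ∫ p, (η p.1 - η (p.1 + p.2)) ^ 2 ∂pairMeasure n s ≤ ε ^ (-s) * ∫ x, η x ^ 2 := by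
    rw [integral_prod _ hi, ← integral_const_mul]
    exact integral_mono hi.integral_prod_left (hηi.const_mul _) hδ
  have h3 : ∫ x, (3 * u x ^ 2 - 1) * η x ^ 2 = -∫ x, η x ^ 2 := by
    rw [← integral_neg]
    congr 1
    funext x
    rw [hconst, h0]
    ring
  rw [h3] at h1
  nlinarith [mul_pos hc hpos]

end NearlyCritical

section Chain

variable {n : ℕ} {s : ℝ}

lemma integrable_sq_sub_translate {f : Rn n → ℝ} (hc : Continuous f)
    (hi : Integrable fun x => f x ^ 2) (w : Rn n) :
    Integrable fun x => (f x - f (x + w)) ^ 2 := by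
  refine ((hi.add (hi.comp_add_right w)).const_mul 2).mono'
    (Continuous.aestronglyMeasurable (by fun_prop)) (ae_of_all _ fun x => ?_)
  rw [Real.norm_eq_abs, abs_of_nonneg (sq_nonneg _)]
  simp only [Pi.add_apply]
  nlinarith [sq_nonneg (f x + f (x + w))]

lemma integral_sq_sub_translate_le {f : Rn n → ℝ} (hc : Continuous f)
    (hi : Integrable fun x => f x ^ 2) (w : Rn n) :
    ∫ x, (f x - f (x + w)) ^ 2 ≤ 4 * ∫ x, f x ^ 2 := by
  have hi' : Integrable fun x => f (x + w) ^ 2 := hi.comp_add_right w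
  have h := integral_mono (integrable_sq_sub_translate hc hi w) ((hi.add hi').const_mul 2)
    fun x => by
      simp only [Pi.add_apply]
      nlinarith [sq_nonneg (f x + f (x + w))]
  simp only [Pi.add_apply] at h
  rw [integral_const_mul, integral_add hi hi',
    integral_add_right_eq_self (fun x => f x ^ 2) w] at h
  linarith

lemma integral_sq_sub_nsmul_le {f : Rn n → ℝ} (hc : Continuous f)
    (hi : Integrable fun x => f x ^ 2) (w : Rn n) (N : ℕ) :
    ∫ x, (f x - f (x + N • w)) ^ 2 ≤ (N : ℝ) ^ 2 * ∫ x, (f x - f (x + w)) ^ 2 := by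
  have h1 := integrable_sq_sub_translate hc hi w
  have h2 : ∀ i : ℕ, Integrable fun x => (f (x + i • w) - f (x + i • w + w)) ^ 2 :=
    fun i => h1.comp_add_right (i • w)
  have h3 : ∀ x, (f x - f (x + N • w)) ^ 2 ≤
      N * ∑ i ∈ Finset.range N, (f (x + i • w) - f (x + i • w + w)) ^ 2 := fun x => by
    have e : f x - f (x + N • w) =
        ∑ i ∈ Finset.range N, (f (x + i • w) - f (x + i • w + w)) := by
      have := Finset.sum_range_sub' (fun i : ℕ => f (x + i • w)) N
      simp only [zero_smul, add_zero, succ_nsmul, ← add_assoc] at this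
      exact this.symm
    rw [e]
    simpa using sq_sum_le_card_mul_sum_sq (s := Finset.range N)
      (f := fun i => f (x + i • w) - f (x + i • w + w))
  refine (integral_mono (integrable_sq_sub_translate hc hi _)
    ((integrable_finsetSum (Finset.range N) fun i _ => h2 i).const_mul (N : ℝ)) h3).trans_eq ?_
  rw [integral_const_mul, integral_finsetSum _ fun i _ => h2 i]
  have h4 : ∀ i ∈ Finset.range N, ∫ x, (f (x + i • w) - f (x + i • w + w)) ^ 2 =
      ∫ x, (f x - f (x + w)) ^ 2 := fun i _ =>
    integral_add_right_eq_self (fun x => (f x - f (x + w)) ^ 2) (i • w)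
  rw [Finset.sum_congr rfl h4]
  simp
  ring

lemma sq_sub_mul_cubic_le {A B p q r : ℝ} (hA : |A| ≤ 1) (hB : |B| ≤ 1) (hAB : |A - B| ≤ r) :
    (p * (A - A ^ 3) - q * (B - B ^ 3)) ^ 2 ≤
      2 * (p - q) ^ 2 + 4 * r ^ 2 * ((3 * A ^ 2 - 1) ^ 2 * p ^ 2) + 36 * r ^ 4 * p ^ 2 := by
  have hB2 := (sq_le_one_iff_abs_le_one _).2 hB
  have hr := pow_le_pow_left₀ (abs_nonneg _) hAB 2
  rw [sq_abs] at hr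
  have hg : (B - B ^ 3) ^ 2 ≤ 1 := by
    have : (B - B ^ 3) ^ 2 = B ^ 2 * (1 - B ^ 2) ^ 2 := by ring
    rw [this]
    nlinarith [sq_nonneg B, mul_nonneg (sq_nonneg B) (sub_nonneg.2 hB2),
      mul_nonneg (mul_nonneg (sq_nonneg B) (sq_nonneg B)) (sub_nonneg.2 hB2)]
  have h9 : (2 * A + B) ^ 2 ≤ 9 := by
    have h1 := abs_le.1 hA
    have h2 := abs_le.1 hB
    nlinarith [h1.1, h1.2, h2.1, h2.2]
  set d := A - B with hd
  have e1 : p * (A - A ^ 3) - q * (B - B ^ 3) =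
      (B - B ^ 3) * (p - q) + p * (d * (-(3 * A ^ 2 - 1) + d * (2 * A + B))) := by
    rw [hd]; ring
  set a := 3 * A ^ 2 - 1
  have h3 : (-a + d * (2 * A + B)) ^ 2 ≤ 2 * a ^ 2 + 18 * r ^ 2 := by
    have h4 : d ^ 2 * (2 * A + B) ^ 2 ≤ r ^ 2 * 9 := mul_le_mul hr h9 (sq_nonneg _) (sq_nonneg _)
    nlinarith [sq_nonneg (a + d * (2 * A + B))]
  have h5 : d ^ 2 * (-a + d * (2 * A + B)) ^ 2 ≤ r ^ 2 * (2 * a ^ 2 + 18 * r ^ 2) :=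
    mul_le_mul hr h3 (sq_nonneg _) (sq_nonneg _)
  have h6 := mul_le_mul_of_nonneg_left h5 (sq_nonneg p)
  have h7 := mul_le_mul_of_nonneg_right hg (sq_nonneg (p - q))
  rw [e1]
  nlinarith [sq_nonneg ((B - B ^ 3) * (p - q) - p * (d * (-a + d * (2 * A + B))))]

lemma abs_cubic_le_one {t : ℝ} (ht : |t| ≤ 1) : |t - t ^ 3| ≤ 1 := by
  have h := (sq_le_one_iff_abs_le_one _).2 ht
  have e : t - t ^ 3 = t * (1 - t ^ 2) := by ring
  rw [e, abs_mul, abs_of_nonneg (sub_nonneg.2 h)]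
  nlinarith [abs_nonneg t, sq_nonneg t]

lemma integral_sq_sub_mul_cubic_le {u φ : Rn n → ℝ} (hu1 : ∀ x, |u x| ≤ 1) {K : NNReal}
    (hlip : LipschitzWith K u) (hφc : Continuous φ) (hφi : Integrable fun x => φ x ^ 2)
    (w : Rn n) :
    ∫ x, (φ x * (u x - u x ^ 3) - φ (x + w) * (u (x + w) - u (x + w) ^ 3)) ^ 2 ≤
      2 * (∫ x, (φ x - φ (x + w)) ^ 2) +
        4 * (K * ‖w‖) ^ 2 * (∫ x, (3 * u x ^ 2 - 1) ^ 2 * φ x ^ 2) +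
        36 * (K * ‖w‖) ^ 4 * ∫ x, φ x ^ 2 := by
  have huc := hlip.continuous
  have hfi : Integrable fun x => (φ x * (u x - u x ^ 3)) ^ 2 := by
    refine hφi.mono' (Continuous.aestronglyMeasurable (by fun_prop)) (ae_of_all _ fun x => ?_)
    have := (sq_le_one_iff_abs_le_one _).2 (abs_cubic_le_one (hu1 x))
    rw [Real.norm_eq_abs, abs_of_nonneg (sq_nonneg _), mul_pow]
    nlinarith [sq_nonneg (φ x)]
  have hai : Integrable fun x => (3 * u x ^ 2 - 1) ^ 2 * φ x ^ 2 := by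
    refine (hφi.const_mul 4).mono' (Continuous.aestronglyMeasurable (by fun_prop))
      (ae_of_all _ fun x => ?_)
    have := (sq_le_one_iff_abs_le_one _).2 (hu1 x)
    rw [Real.norm_eq_abs, abs_of_nonneg (by positivity)]
    refine mul_le_mul_of_nonneg_right ?_ (sq_nonneg _)
    nlinarith [sq_nonneg (u x)]
  refine integral_le_of_le_add_three
    (integrable_sq_sub_translate (f := fun x => φ x * (u x - u x ^ 3)) (by fun_prop) hfi w)
    (integrable_sq_sub_translate hφc hφi w) hai hφi _ _ _ fun x => ?_
  refine sq_sub_mul_cubic_le (hu1 x) (hu1 _) ?_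
  have h1 := hlip.dist_le_mul x (x + w)
  rwa [Real.dist_eq, dist_eq_norm, sub_add_cancel_left, norm_neg] at h1

end Chain

section Instability

variable {n : ℕ} {s : ℝ}

lemma BddLip.cubic {C : ℝ} {u : Rn n → ℝ} (hu : BddLip C u) (hu1 : ∀ x, |u x| ≤ 1) :
    BddLip (1 + 2 * C) fun x => u x - u x ^ 3 := by
  have hc := hu.1
  have hC := hu.nonneg
  refine ⟨by fun_prop, fun x => (abs_cubic_le_one (hu1 x)).trans (by linarith), fun x z => ?_⟩
  have e : u x - u x ^ 3 - (u (x + z) - u (x + z) ^ 3) =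
      (1 - (u x ^ 2 + u x * u (x + z) + u (x + z) ^ 2)) * (u x - u (x + z)) := by ring
  have h1 : |1 - (u x ^ 2 + u x * u (x + z) + u (x + z) ^ 2)| ≤ 2 := by
    have h1 := (sq_le_one_iff_abs_le_one _).2 (hu1 x)
    have h2 := (sq_le_one_iff_abs_le_one _).2 (hu1 (x + z))
    rw [abs_le]
    constructor <;> nlinarith [sq_nonneg (u x - u (x + z)), sq_nonneg (u x + u (x + z)),
      sq_nonneg (u x), sq_nonneg (u (x + z))]
  rw [e, abs_mul]
  have hm := min_one_norm_nonneg z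
  calc _ ≤ 2 * (C * min 1 ‖z‖) := mul_le_mul h1 (hu.2.2 x z) (abs_nonneg _) (by norm_num)
    _ ≤ (1 + 2 * C) * min 1 ‖z‖ := by linarith

lemma integrable_mul_cubic_sq {u φ : Rn n → ℝ} (hu1 : ∀ x, |u x| ≤ 1) (huc : Continuous u)
    (hφc : Continuous φ) (hφi : Integrable fun x => φ x ^ 2) :
    Integrable fun x => (φ x * (u x - u x ^ 3)) ^ 2 := by
  refine hφi.mono' (Continuous.aestronglyMeasurable (by fun_prop)) (ae_of_all _ fun x => ?_)
  have := (sq_le_one_iff_abs_le_one _).2 (abs_cubic_le_one (hu1 x))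
  rw [Real.norm_eq_abs, abs_of_nonneg (sq_nonneg _), mul_pow]
  nlinarith [sq_nonneg (φ x)]

lemma integral_mul_cubic_sq_le {u φ : Rn n → ℝ} (hu1 : ∀ x, |u x| ≤ 1) (huc : Continuous u)
    (hφc : Continuous φ) (hφi : Integrable fun x => φ x ^ 2) :
    ∫ x, (φ x * (u x - u x ^ 3)) ^ 2 ≤ ∫ x, φ x ^ 2 :=
  integral_mono (integrable_mul_cubic_sq hu1 huc hφc hφi) hφi fun x => by
    have := (sq_le_one_iff_abs_le_one _).2 (abs_cubic_le_one (hu1 x))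
    simp only
    rw [mul_pow]
    nlinarith [sq_nonneg (φ x)]

lemma integrable_sq_sub_mul_cubic (hn : 1 ≤ n) (hs : s ∈ Ioo (0 : ℝ) 1) {C : ℝ} {u φ : Rn n → ℝ}
    (huB : BddLip C u) (hu1 : ∀ x, |u x| ≤ 1) (hφc : Continuous φ)
    (hφi : Integrable fun x => φ x ^ 2)
    (hdi : Integrable (fun p => (φ p.1 - φ (p.1 + p.2)) ^ 2) (pairMeasure n s)) :
    Integrable (fun p => (φ p.1 * (u p.1 - u p.1 ^ 3) -
      φ (p.1 + p.2) * (u (p.1 + p.2) - u (p.1 + p.2) ^ 3)) ^ 2) (pairMeasure n s) := by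
  have huc := huB.1
  have hg := (huB.cubic hu1).integrable_sq_mul hn hs hφc hφi
  refine ((hdi.const_mul 2).add (hg.const_mul 2)).mono'
    (Continuous.aestronglyMeasurable (by fun_prop)) (ae_of_all _ fun p => ?_)
  have h := (sq_le_one_iff_abs_le_one _).2 (abs_cubic_le_one (hu1 (p.1 + p.2)))
  rw [Real.norm_eq_abs, abs_of_nonneg (sq_nonneg _)]
  simp only [Pi.add_apply]
  set g₁ := u p.1 - u p.1 ^ 3
  set g₂ := u (p.1 + p.2) - u (p.1 + p.2) ^ 3
  have e : φ p.1 * g₁ - φ (p.1 + p.2) * g₂ =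
      g₂ * (φ p.1 - φ (p.1 + p.2)) + φ p.1 * (g₁ - g₂) := by ring
  rw [e]
  nlinarith [mul_le_mul_of_nonneg_right h (sq_nonneg (φ p.1 - φ (p.1 + p.2))),
    sq_nonneg (g₂ * (φ p.1 - φ (p.1 + p.2)) - φ p.1 * (g₁ - g₂))]

lemma chain_energy_le (hn : 1 ≤ n) (hs : s ∈ Ioo (0 : ℝ) 1) {u φ : Rn n → ℝ}
    (hu1 : ∀ x, |u x| ≤ 1) {K : NNReal} (hlip : LipschitzWith K u) (hφc : Continuous φ)
    (hφi : Integrable fun x => φ x ^ 2)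
    (hdi : Integrable (fun p => (φ p.1 - φ (p.1 + p.2)) ^ 2) (pairMeasure n s)) {τ : ℝ}
    (hτ : 0 ≤ τ)
    (hd : ∫ p, (φ p.1 - φ (p.1 + p.2)) ^ 2 ∂pairMeasure n s ≤ τ * ∫ x, φ x ^ 2)
    (ha : ∫ x, (3 * u x ^ 2 - 1) ^ 2 * φ x ^ 2 ≤ τ * ∫ x, φ x ^ 2) {T : ℝ} (hT : 1 ≤ T) {N : ℕ}
    (hN : 1 ≤ N) :
    ∫ p, (φ p.1 * (u p.1 - u p.1 ^ 3) -
        φ (p.1 + p.2) * (u (p.1 + p.2) - u (p.1 + p.2) ^ 3)) ^ 2 ∂pairMeasure n s ≤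
      (4 * ((T⁻¹) ^ s * ∫ z, min 1 ‖z‖ ∂jumpMeasure n s) +
        (4 * K ^ 2 * T ^ 2 * τ + 36 * K ^ 4 * T ^ 4 / N ^ 2) *
          (∫ z, min 1 ‖z‖ ∂jumpMeasure n s) + 2 * N ^ 2 * τ) * ∫ x, φ x ^ 2 := by
  have huc := hlip.continuous
  have hfi := integrable_mul_cubic_sq hu1 huc hφc hφi
  have hfI := integrable_sq_sub_mul_cubic hn hs (hlip.bddLip hu1) hu1 hφc hφi hdi
  have hle4 := integral_mul_cubic_sq_le hu1 huc hφc hφi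
  set M := ∫ x, φ x ^ 2 with hM
  set κ := ∫ z, min 1 ‖z‖ ∂jumpMeasure n s with hκ
  have hM0 : 0 ≤ M := integral_nonneg fun x => sq_nonneg _
  have hT0 : 0 < T := zero_lt_one.trans_le hT
  have hN0 : (0 : ℝ) < N := by exact_mod_cast hN
  have hN1 : (1 : ℝ) ≤ N := by exact_mod_cast hN
  set D : Rn n → ℝ := fun w => ∫ x, (φ x - φ (x + w)) ^ 2 with hD
  have hD0 : ∀ w, 0 ≤ D w := fun w => integral_nonneg fun x => sq_nonneg _
  have hDi : Integrable D (jumpMeasure n s) := hdi.integral_prod_right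
  have hDint : ∫ w, D w ∂jumpMeasure n s ≤ τ * M := by
    rwa [integral_prod_symm _ hdi] at hd
  have hNi : (0 : ℝ) < (N : ℝ)⁻¹ := inv_pos.2 hN0
  have hTi : 0 < T⁻¹ := inv_pos.2 hT0
  have hpt : ∀ z, ∫ x, (φ x * (u x - u x ^ 3) - φ (x + z) * (u (x + z) - u (x + z) ^ 3)) ^ 2 ≤
      (4 * M) * min 1 ‖T⁻¹ • z‖ +
        ((4 * K ^ 2 * T ^ 2 * τ + 36 * K ^ 4 * T ^ 4 / N ^ 2) * M) * min 1 ‖z‖ +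
        (2 * N ^ 2) * D ((N : ℝ)⁻¹ • z) := fun z => by
    have hm := min_one_norm_nonneg z
    have hm' := min_one_norm_nonneg (T⁻¹ • z)
    have hDz := hD0 ((N : ℝ)⁻¹ • z)
    rcases le_total T ‖z‖ with hz | hz
    · have h1 : min 1 ‖T⁻¹ • z‖ = 1 := by
        rw [norm_smul, Real.norm_eq_abs, abs_of_pos hTi]
        exact min_eq_left ((one_le_inv_mul₀ hT0).2 hz)
      rw [h1]
      have h2 := integral_sq_sub_translate_le (f := fun x => φ x * (u x - u x ^ 3))
        (by fun_prop) hfi z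
      have h3 : 0 ≤ ((4 * K ^ 2 * T ^ 2 * τ + 36 * K ^ 4 * T ^ 4 / N ^ 2) * M) * min 1 ‖z‖ := by
        positivity
      have h4 : 0 ≤ (2 * (N : ℝ) ^ 2) * D ((N : ℝ)⁻¹ • z) := by positivity
      linarith
    · have h1 := integral_sq_sub_nsmul_le (f := fun x => φ x * (u x - u x ^ 3))
        (by fun_prop) hfi ((N : ℝ)⁻¹ • z) N
      rw [← Nat.cast_smul_eq_nsmul ℝ N, smul_smul, mul_inv_cancel₀ hN0.ne', one_smul] at h1
      have h2 := integral_sq_sub_mul_cubic_le hu1 hlip hφc hφi ((N : ℝ)⁻¹ • z)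
      have hnz : ‖(N : ℝ)⁻¹ • z‖ = (N : ℝ)⁻¹ * ‖z‖ := by
        rw [norm_smul, Real.norm_eq_abs, abs_of_pos hNi]
      rw [hnz] at h2
      have hz2 : ‖z‖ ^ 2 ≤ T ^ 2 * min 1 ‖z‖ := by
        rcases le_total ‖z‖ 1 with h | h
        · rw [min_eq_right h]
          nlinarith [norm_nonneg z, mul_nonneg (norm_nonneg z) (sub_nonneg.2 h),
            mul_nonneg (norm_nonneg z) (sub_nonneg.2 (one_le_pow₀ hT : 1 ≤ T ^ 2))]
        · rw [min_eq_left h, mul_one]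
          exact pow_le_pow_left₀ (norm_nonneg z) hz 2
      have hz4 : ‖z‖ ^ 4 ≤ T ^ 4 * min 1 ‖z‖ := by
        have h5 := mul_le_mul hz2 (pow_le_pow_left₀ (norm_nonneg z) hz 2) (by positivity)
          (by positivity)
        nlinarith
      have h3 : 4 * (K * ((N : ℝ)⁻¹ * ‖z‖)) ^ 2 * (∫ x, (3 * u x ^ 2 - 1) ^ 2 * φ x ^ 2) ≤
          (N : ℝ)⁻¹ ^ 2 * (4 * K ^ 2 * (T ^ 2 * min 1 ‖z‖) * (τ * M)) := by
        have e : 4 * (K * ((N : ℝ)⁻¹ * ‖z‖)) ^ 2 * (∫ x, (3 * u x ^ 2 - 1) ^ 2 * φ x ^ 2) =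
          (N : ℝ)⁻¹ ^ 2 * (4 * K ^ 2 * ‖z‖ ^ 2 * (∫ x, (3 * u x ^ 2 - 1) ^ 2 * φ x ^ 2)) := by
          ring
        rw [e]
        have : 0 ≤ ∫ x, (3 * u x ^ 2 - 1) ^ 2 * φ x ^ 2 := integral_nonneg fun x => by positivity
        gcongr
      have h4 : 36 * (K * ((N : ℝ)⁻¹ * ‖z‖)) ^ 4 * M ≤
          (N : ℝ)⁻¹ ^ 4 * (36 * K ^ 4 * (T ^ 4 * min 1 ‖z‖) * M) := by
        have e : 36 * (K * ((N : ℝ)⁻¹ * ‖z‖)) ^ 4 * M =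
          (N : ℝ)⁻¹ ^ 4 * (36 * K ^ 4 * ‖z‖ ^ 4 * M) := by ring
        rw [e]
        gcongr
      have h5 := mul_le_mul_of_nonneg_left (h2.trans (add_le_add (add_le_add le_rfl h3) h4))
        (sq_nonneg (N : ℝ))
      refine (h1.trans h5).trans ?_
      have e : (N : ℝ) ^ 2 * (2 * D ((N : ℝ)⁻¹ • z) +
          (N : ℝ)⁻¹ ^ 2 * (4 * K ^ 2 * (T ^ 2 * min 1 ‖z‖) * (τ * M)) +
          (N : ℝ)⁻¹ ^ 4 * (36 * K ^ 4 * (T ^ 4 * min 1 ‖z‖) * M)) =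
          ((4 * K ^ 2 * T ^ 2 * τ + 36 * K ^ 4 * T ^ 4 / N ^ 2) * M) * min 1 ‖z‖ +
        (2 * N ^ 2) * D ((N : ℝ)⁻¹ • z) := by
        field_simp
        ring
      change (N : ℝ) ^ 2 * (2 * D ((N : ℝ)⁻¹ • z) + _ + _) ≤ _
      rw [e]
      have : 0 ≤ (4 * M) * min 1 ‖T⁻¹ • z‖ := by positivity
      linarith
  rw [integral_prod_symm _ hfI]
  have hmi := integrable_min_one_norm hn hs
  refine (integral_le_of_le_add_three hfI.integral_prod_right
    (integrable_jumpMeasure_comp_smul hs hTi hmi) hmi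
    (integrable_jumpMeasure_comp_smul hs hNi hDi) _ _ _ hpt).trans ?_
  rw [integral_jumpMeasure_comp_smul hs (fun z => min 1 ‖z‖) hTi,
    integral_jumpMeasure_comp_smul hs D hNi, ← hκ]
  have h1 : (N : ℝ)⁻¹ ^ s ≤ 1 :=
    Real.rpow_le_one hNi.le (inv_le_one_of_one_le₀ hN1) hs.1.le
  have h2 : (N : ℝ)⁻¹ ^ s * ∫ w, D w ∂jumpMeasure n s ≤ 1 * (τ * M) :=
    mul_le_mul h1 hDint (integral_nonneg hD0) zero_le_one
  have h3 := mul_le_mul_of_nonneg_left h2 (show 0 ≤ 2 * (N : ℝ) ^ 2 by positivity)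
  linarith

lemma integral_sq_mul_cubic_le (hn : 1 ≤ n) (hs : s ∈ Ioo (0 : ℝ) 1) {c : ℝ} {C : ℝ}
    {u φ : Rn n → ℝ} (huB : BddLip C u) (hu1 : ∀ x, |u x| ≤ 1)
    (hsol : ∀ x, jumpOp n s u x = c * (u x - u x ^ 3)) (hφc : Continuous φ)
    (hφi : Integrable fun x => φ x ^ 2)
    (hdi : Integrable (fun p => (φ p.1 - φ (p.1 + p.2)) ^ 2) (pairMeasure n s)) {θ : ℝ}
    (hθ : 0 < θ) :
    2 * c * ∫ x, (φ x * (u x - u x ^ 3)) ^ 2 ≤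
      2 * θ * (C ^ 2 * (∫ z, min 1 ‖z‖ ∂jumpMeasure n s) * ∫ x, φ x ^ 2) +
      1 / θ * ((∫ p, (φ p.1 * (u p.1 - u p.1 ^ 3) -
        φ (p.1 + p.2) * (u (p.1 + p.2) - u (p.1 + p.2) ^ 3)) ^ 2 ∂pairMeasure n s) +
        ∫ p, (φ p.1 - φ (p.1 + p.2)) ^ 2 ∂pairMeasure n s) := by
  have huc := huB.1
  have hfI := integrable_sq_sub_mul_cubic hn hs huB hu1 hφc hφi hdi
  have hg : Integrable fun x => φ x ^ 2 * (u x - u x ^ 3) := by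
    refine hφi.mono' (Continuous.aestronglyMeasurable (by fun_prop)) (ae_of_all _ fun x => ?_)
    rw [norm_mul, Real.norm_eq_abs, Real.norm_eq_abs, abs_of_nonneg (sq_nonneg _)]
    nlinarith [abs_cubic_le_one (hu1 x), sq_nonneg (φ x)]
  have hw := huB.integrable_sub_mul_sub hn hs (g := fun x => φ x ^ 2 * (u x - u x ^ 3))
    (by fun_prop) hg
  have hw' := huB.integral_sub_mul_sub hn hs (g := fun x => φ x ^ 2 * (u x - u x ^ 3))
    (by fun_prop) hg
  have e1 : 2 * ∫ x, φ x ^ 2 * (u x - u x ^ 3) * jumpOp n s u x =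
      2 * c * ∫ x, (φ x * (u x - u x ^ 3)) ^ 2 := by
    have : ∀ x, φ x ^ 2 * (u x - u x ^ 3) * jumpOp n s u x =
      c * (φ x * (u x - u x ^ 3)) ^ 2 := fun x => by rw [hsol]; ring
    simp only [this, integral_const_mul]
    ring
  have hφu := huB.integrable_sq_mul hn hs hφc hφi
  have hle := huB.integral_sq_mul_le hn hs hφc hφi
  have hφu' : Integrable (fun p => φ (p.1 + p.2) ^ 2 * (u (p.1 + p.2) - u p.1) ^ 2)
      (pairMeasure n s) := integrable_reflect (H := fun x y => φ x ^ 2 * (u x - u y) ^ 2) hφu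
  have hle' := (integral_reflect (n := n) (s := s)
    (H := fun x y => φ x ^ 2 * (u x - u y) ^ 2)).trans_le hle
  have hint := integral_le_of_le_add_four hw hφu hφu' hfI hdi θ θ (1 / θ) (1 / θ) fun p => by
    have hg2 := (sq_le_one_iff_abs_le_one _).2 (abs_cubic_le_one (hu1 (p.1 + p.2)))
    set g₁ := u p.1 - u p.1 ^ 3
    set g₂ := u (p.1 + p.2) - u (p.1 + p.2) ^ 3
    set a := u p.1 - u (p.1 + p.2) with ha
    have ha' : (u (p.1 + p.2) - u p.1) ^ 2 = a ^ 2 := by rw [ha]; ring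
    rw [ha']
    set p₁ := φ p.1
    set p₂ := φ (p.1 + p.2)
    have young : ∀ x y : ℝ, x * y ≤ θ * x ^ 2 + 1 / θ * y ^ 2 := fun x y => by
      have h1 : 0 ≤ 1 / θ * (2 * θ * x - y) ^ 2 := by positivity
      have h2 : 1 / θ * (2 * θ * x - y) ^ 2 = 4 * θ * x ^ 2 - 4 * (x * y) + 1 / θ * y ^ 2 := by
        field_simp
        ring
      have h3 : 0 ≤ 1 / θ * y ^ 2 := by positivity
      linarith
    have h1 := young (p₁ * a) (p₁ * g₁ - p₂ * g₂)
    have h2 := young (p₂ * g₂ * a) (p₁ - p₂)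
    have h3 : θ * (p₂ * g₂ * a) ^ 2 ≤ θ * (p₂ ^ 2 * a ^ 2) := by
      refine mul_le_mul_of_nonneg_left ?_ hθ.le
      have := mul_le_mul_of_nonneg_right hg2 (mul_nonneg (sq_nonneg p₂) (sq_nonneg a))
      linarith
    linarith
  rw [hw', e1] at hint
  have h1 := mul_le_mul_of_nonneg_left hle hθ.le
  have h2 := mul_le_mul_of_nonneg_left hle' hθ.le
  linarith

/-- No entire solution has nonnegative second variation. -/
lemma not_stable (hn : 1 ≤ n) (hs : s ∈ Ioo (0 : ℝ) 1) {ε : ℝ} (hε : 0 < ε)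
    {u : Rn n → ℝ} (hu1 : ∀ x, |u x| < 1) {K : NNReal} (hlip : LipschitzWith K u)
    (hC1 : ContDiff ℝ 1 u) (hsol : ∀ x, jumpOp n s u x = ε ^ (-s) * (u x - u x ^ 3))
    (hQ : ∀ ξ, IsCc1On n univ ξ → 0 ≤ Qform n s ε u univ ξ) : False := by
  by_cases hnc : ∀ x, u x = u 0
  · exact not_stable_of_const hn hs hε hu1 hlip.continuous hsol hQ hnc
  have hu1' := fun x => (hu1 x).le
  have huc := hlip.continuous
  have huB := hlip.bddLip hu1'
  set B := max (K : ℝ) (2 * 1)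
  set c := ε ^ (-s) with hc_def
  have hc : 0 < c := Real.rpow_pos_of_pos hε _
  set κ := ∫ z : Rn n, min 1 ‖z‖ ∂jumpMeasure n s with hκ
  have hκ0 : 0 ≤ κ := integral_nonneg fun z => min_one_norm_nonneg z
  set θ := c / (40 * (B ^ 2 * κ + 1)) with hθ_def
  have hθ : 0 < θ := by positivity
  have hθ1 : 40 * (θ * (B ^ 2 * κ)) ≤ c := by
    have : θ * (40 * (B ^ 2 * κ + 1)) = c := by rw [hθ_def]; field_simp
    nlinarith
  set σ := 2 * θ * c / 40 with hσ_def
  have hσ : 0 < σ := by positivity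
  obtain ⟨T, hT1, hTσ⟩ : ∃ T : ℝ, 1 ≤ T ∧ 4 * ((T⁻¹) ^ s * κ) ≤ σ / 5 := by
    have h1 : Tendsto (fun T : ℝ => 4 * ((T⁻¹) ^ s * κ)) atTop (𝓝 (4 * (0 ^ s * κ))) :=
      ((tendsto_inv_atTop_zero.rpow_const (Or.inr hs.1.le)).mul_const κ).const_mul 4
    rw [Real.zero_rpow hs.1.ne', zero_mul, mul_zero] at h1
    obtain ⟨T, h2, h3⟩ := ((h1.eventually (gt_mem_nhds (show 0 < σ / 5 by positivity))).and
      (eventually_ge_atTop 1)).exists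
    exact ⟨T, h3, h2.le⟩
  obtain ⟨N, hN1, hNσ⟩ : ∃ N : ℕ, 1 ≤ N ∧ 36 * K ^ 4 * T ^ 4 / N ^ 2 * κ ≤ σ / 5 := by
    obtain ⟨N, hN⟩ := exists_nat_gt (max 1 (36 * K ^ 4 * T ^ 4 * κ / (σ / 5)))
    have h1 := (le_max_left _ _).trans_lt hN
    have h2 := (le_max_right _ _).trans_lt hN
    refine ⟨N, by exact_mod_cast h1.le, ?_⟩
    have hN0 : (0 : ℝ) < N := zero_lt_one.trans h1
    rw [div_lt_iff₀ (by positivity)] at h2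
    rw [div_mul_eq_mul_div, div_le_iff₀ (by positivity)]
    nlinarith [mul_nonneg (mul_nonneg hσ.le hN0.le) (sub_nonneg.2 h1.le)]
  set S := 4 * K ^ 2 * T ^ 2 * κ + 2 * (N : ℝ) ^ 2 + 1 with hS_def
  have hS : 0 < S := by positivity
  set τ := min (1 / 40) (σ / 5 / S) with hτ_def
  have hτ : 0 < τ := by positivity
  have hτ1 : τ ≤ 1 / 40 := min_le_left _ _
  have hτS : τ * S ≤ σ / 5 := (le_div_iff₀ hS).1 (min_le_right _ _)
  obtain ⟨φ, hφc, hφi, hM, hdi, hd, ha⟩ := exists_nearly_critical hn hs hε hu1' hlip hC1 hsol hQ hnc hτ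
  have hchain := chain_energy_le hn hs hu1' hlip hφc hφi hdi hτ.le hd ha hT1 hN1
  have hcub := integral_sq_mul_cubic_le hn hs huB hu1' hsol hφc hφi hdi hθ
  have hfi := integrable_mul_cubic_sq hu1' huc hφc hφi
  have hai : Integrable fun x => (3 * u x ^ 2 - 1) ^ 2 * φ x ^ 2 := by
    refine (hφi.const_mul 4).mono' (Continuous.aestronglyMeasurable (by fun_prop))
      (ae_of_all _ fun x => ?_)
    have := (sq_le_one_iff_abs_le_one _).2 (hu1' x)
    rw [Real.norm_eq_abs, abs_of_nonneg (by positivity)]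
    refine mul_le_mul_of_nonneg_right ?_ (sq_nonneg _)
    nlinarith [sq_nonneg (u x)]
  have hlow := integral_le_of_le_add_three hφi hfi hai hφi 10 10 0 fun x => by
    have h1 := (sq_le_one_iff_abs_le_one _).2 (hu1' x)
    have h2 : 1 ≤ 10 * (u x - u x ^ 3) ^ 2 + 10 * (3 * u x ^ 2 - 1) ^ 2 := by
      have e : (u x - u x ^ 3) ^ 2 = u x ^ 2 * (1 - u x ^ 2) ^ 2 := by ring
      rw [e]
      set r := u x ^ 2
      have hr : 0 ≤ r := sq_nonneg _
      nlinarith [mul_nonneg hr (sq_nonneg (1 - r)), sq_nonneg (3 * r - 1),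
        mul_nonneg hr (sq_nonneg (3 * r - 1)), sq_nonneg (r - 1 / 3)]
    have := mul_le_mul_of_nonneg_right h2 (sq_nonneg (φ x))
    linarith
  set M := ∫ x, φ x ^ 2
  set I := ∫ p, (φ p.1 * (u p.1 - u p.1 ^ 3) -
        φ (p.1 + p.2) * (u (p.1 + p.2) - u (p.1 + p.2) ^ 3)) ^ 2 ∂pairMeasure n s
  have hI : I + ∫ p, (φ p.1 - φ (p.1 + p.2)) ^ 2 ∂pairMeasure n s ≤ σ * M := by
    have h1 : (4 * ((T⁻¹) ^ s * κ) + (4 * K ^ 2 * T ^ 2 * τ + 36 * K ^ 4 * T ^ 4 / N ^ 2) * κ +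
        2 * N ^ 2 * τ) + τ ≤ σ := by
      rw [hS_def] at hτS
      linarith
    have := mul_le_mul_of_nonneg_right h1 hM.le
    linarith
  have h1 := mul_le_mul_of_nonneg_left hI (show 0 ≤ 1 / θ by positivity)
  have e1 : 1 / θ * (σ * M) = 2 * c / 40 * M := by rw [hσ_def]; field_simp
  rw [e1] at h1
  have h2 := mul_le_mul_of_nonneg_right hθ1 hM.le
  have h3 : 2 * c * ∫ x, (φ x * (u x - u x ^ 3)) ^ 2 ≤ 2 * c * (1 / 20 * M) := by linarith
  have h4 := le_of_mul_le_mul_left h3 (by positivity)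
  have h5 := mul_le_mul_of_nonneg_right hτ1 hM.le
  linarith

end Instability

section FiniteIndex

variable {n : ℕ} {s : ℝ}

lemma IsACSol.jumpOp_eq (hs : s ∈ Ioo (0 : ℝ) 1) {ε : ℝ} {u : Rn n → ℝ}
    (h : IsACSol n s ε u univ) (x : Rn n) : jumpOp n s u x = ε ^ (-s) * (u x - u x ^ 3) := by
  have h1 := h x (mem_univ x)
  rw [integral_mul_fracKer hs (fun x y => u x - u y) x] at h1
  unfold jumpOp
  linarith

lemma Qform_const_mul (hs : s ∈ Ioo (0 : ℝ) 1) (ε : ℝ) (u ξ : Rn n → ℝ) (a : ℝ) :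
    Qform n s ε u univ (fun x => a * ξ x) = a ^ 2 * Qform n s ε u univ ξ := by
  rw [Qform_univ hs, Qform_univ hs]
  have e1 : ∀ p : Rn n × Rn n, (a * ξ p.1 - a * ξ (p.1 + p.2)) ^ 2 =
      a ^ 2 * (ξ p.1 - ξ (p.1 + p.2)) ^ 2 := fun p => by ring
  have e2 : ∀ x, (3 * u x ^ 2 - 1) * (a * ξ x) ^ 2 = a ^ 2 * ((3 * u x ^ 2 - 1) * ξ x ^ 2) :=
    fun x => by ring
  simp only [e1, e2, integral_const_mul]
  ring

lemma Qform_zero (ε : ℝ) (u : Rn n → ℝ) : Qform n s ε u univ 0 = 0 := by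
  simp [Qform]

lemma ACMorseIndexLE.Qform_nonneg (hs : s ∈ Ioo (0 : ℝ) 1) {ε : ℝ} {u : Rn n → ℝ}
    (h : ACMorseIndexLE n s ε u univ 0) {ξ : Rn n → ℝ} (hξ : IsCc1On n univ ξ) :
    0 ≤ Qform n s ε u univ ξ := by
  by_cases h0 : ξ = 0
  · rw [h0, Qform_zero]
  obtain ⟨a, ha, hQ⟩ := h (fun _ => ξ) (fun _ => hξ)
    ((linearIndependent_unique_iff (ι := Fin 1) (R := ℝ) (v := fun _ => ξ)).2 h0)
  simp only [Fin.sum_univ_succ, Finset.univ_eq_empty, Finset.sum_empty, add_zero] at hQ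
  rw [Qform_const_mul hs] at hQ
  have ha0 : a 0 ≠ 0 := fun h => ha (funext fun i => by rwa [Fin.fin_one_eq_zero i])
  exact nonneg_of_mul_nonneg_right hQ (by positivity)

lemma IsCc1On.exists_bddLip {Ω : Set (Rn n)} {ξ : Rn n → ℝ} (h : IsCc1On n Ω ξ) :
    ∃ C, BddLip C ξ := by
  obtain ⟨K, hK⟩ := h.1.lipschitzWith_of_hasCompactSupport h.2.1 one_ne_zero
  obtain ⟨B, hB⟩ := h.2.1.exists_bound_of_continuous h.1.continuous
  exact ⟨_, hK.bddLip hB⟩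

lemma IsCc1On.integrable {Ω : Set (Rn n)} {ξ : Rn n → ℝ} (h : IsCc1On n Ω ξ) : Integrable ξ :=
  h.1.continuous.integrable_of_hasCompactSupport h.2.1

lemma IsCc1On.mem_of_ne_zero {Ω : Set (Rn n)} {ξ : Rn n → ℝ} (h : IsCc1On n Ω ξ) {x : Rn n}
    (hx : ξ x ≠ 0) : x ∈ Ω :=
  h.2.2 (subset_tsupport ξ hx)

lemma IsCc1On.integrable_sq_sub (hn : 1 ≤ n) (hs : s ∈ Ioo (0 : ℝ) 1) {Ω : Set (Rn n)}
    {ξ : Rn n → ℝ} (h : IsCc1On n Ω ξ) :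
    Integrable (fun p => (ξ p.1 - ξ (p.1 + p.2)) ^ 2) (pairMeasure n s) := by
  obtain ⟨C, hC⟩ := h.exists_bddLip
  simpa only [sq] using hC.integrable_sub_mul_sub hn hs h.1.continuous h.integrable

lemma integrable_cross_and_integral_le (hs : s ∈ Ioo (0 : ℝ) 1) {f g : Rn n → ℝ}
    (hfc : Continuous f) (hgc : Continuous g) (hf : Integrable f) (hg : Integrable g) {B : ℝ}
    (hB : ∀ x y, f x ≠ 0 → g y ≠ 0 → fracKer n s x y ≤ B) :
    Integrable (fun p => |f p.1| * |g (p.1 + p.2)|) (pairMeasure n s) ∧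
      ∫ p, |f p.1| * |g (p.1 + p.2)| ∂pairMeasure n s ≤ B * ((∫ x, |f x|) * ∫ x, |g x|) := by
  have hle : ∀ p : Rn n × Rn n, |f p.1| * |g p.2| * fracKer n s p.1 p.2 ≤
      B * (|f p.1| * |g p.2|) := fun p => by
    by_cases h1 : f p.1 = 0
    · simp [h1]
    by_cases h2 : g p.2 = 0
    · simp [h2]
    rw [mul_comm]
    exact mul_le_mul_of_nonneg_right (hB _ _ h1 h2) (by positivity)
  have hprod : Integrable (fun p : Rn n × Rn n => |f p.1| * |g p.2|) (volume.prod volume) :=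
    hf.abs.mul_prod hg.abs
  have hm : Measurable fun p : Rn n × Rn n => fracKer n s p.1 p.2 := by
    unfold fracKer
    fun_prop
  have hi : Integrable (fun p : Rn n × Rn n => |f p.1| * |g p.2| * fracKer n s p.1 p.2)
      (volume.prod volume) := by
    refine (hprod.const_mul B).mono'
      (((Continuous.measurable (by fun_prop)).mul hm).aestronglyMeasurable)
      (ae_of_all _ fun p => ?_)
    rw [Real.norm_eq_abs, abs_of_nonneg (mul_nonneg (by positivity) (fracKer_nonneg hs _ _))]
    exact hle p
  refine ⟨(integrable_pairMeasure_iff hs (H := fun x y => |f x| * |g y|)).2 hi, ?_⟩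
  rw [integral_pairMeasure hs (fun x y => |f x| * |g y|),
    ← integral_prod_mul (fun x => |f x|) (fun x => |g x|), ← integral_const_mul]
  exact integral_mono hi (hprod.const_mul B) hle

lemma sum_sum_ite_ne_le {m : ℕ} (b : Fin (m + 1) → ℝ) :
    ∑ i, ∑ j, (if i = j then 0 else b i * b j) ≤ m * ∑ i, b i ^ 2 := by
  have h1 : ∀ i, ∑ j, (if i = j then 0 else b i * b j) = b i * (∑ j, b j) - b i ^ 2 := fun i => by
    have : ∀ j, (if i = j then 0 else b i * b j) = b i * b j - if i = j then b i * b j else 0 :=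
      fun j => by split_ifs <;> simp
    simp only [this, Finset.sum_sub_distrib, Finset.sum_ite_eq, Finset.mem_univ, if_true,
      ← Finset.mul_sum]
    ring
  simp only [h1, Finset.sum_sub_distrib, ← Finset.sum_mul]
  have h2 := sq_sum_le_card_mul_sum_sq (s := (Finset.univ : Finset (Fin (m + 1)))) (f := b)
  simp only [Finset.card_univ, Fintype.card_fin] at h2
  push_cast at h2
  linarith

lemma sq_sum_sub_le_of_disjoint {ι : Type*} [Fintype ι] [DecidableEq ι] (a p q : ι → ℝ)
    (hp : ∀ i j, i ≠ j → p i * p j = 0) (hq : ∀ i j, i ≠ j → q i * q j = 0) :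
    ((∑ i, a i * p i) - ∑ i, a i * q i) ^ 2 ≤ (∑ i, a i ^ 2 * (p i - q i) ^ 2) +
      ∑ i, ∑ j, (if i = j then 0 else |a i| * |a j| * (|p i| * |q j| + |p j| * |q i|)) := by
  rw [← Finset.sum_sub_distrib, sq, Finset.sum_mul_sum, ← Finset.sum_add_distrib]
  refine Finset.sum_le_sum fun i _ => ?_
  have h1 : a i ^ 2 * (p i - q i) ^ 2 = ∑ j, if i = j then a i ^ 2 * (p i - q i) ^ 2 else 0 := by
    simp
  rw [h1, ← Finset.sum_add_distrib]
  refine Finset.sum_le_sum fun j _ => ?_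
  split_ifs with h
  · subst h
    exact le_of_eq (by ring)
  · have e : (a i * p i - a i * q i) * (a j * p j - a j * q j) =
        a i * a j * (p i * p j + q i * q j) - a i * a j * (p i * q j + p j * q i) := by ring
    rw [e, hp i j h, hq i j h, add_zero, mul_zero, zero_sub, zero_add]
    refine (neg_le_abs _).trans ?_
    rw [abs_mul, abs_mul, ← abs_mul (p i), ← abs_mul (p j)]
    exact mul_le_mul_of_nonneg_left (abs_add_le _ _) (by positivity)

/-- Superposition bound: combinations of disjointly supported test functions interact only through
the kernel between their supports. -/
lemma Qform_sum_le (hn : 1 ≤ n) (hs : s ∈ Ioo (0 : ℝ) 1) {ε : ℝ} {u : Rn n → ℝ}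
    (huc : Continuous u) {m : ℕ} {ξ : Fin (m + 1) → Rn n → ℝ}
    (hξ : ∀ i, IsCc1On n univ (ξ i)) (hdisj : ∀ i j, i ≠ j → ∀ x, ξ i x * ξ j x = 0) {B : ℝ}
    (hB0 : 0 ≤ B)
    (hB : ∀ i j, i ≠ j → ∀ x y, ξ i x ≠ 0 → ξ j y ≠ 0 → fracKer n s x y ≤ B)
    (a : Fin (m + 1) → ℝ) :
    Qform n s ε u univ (fun x => ∑ i, a i * ξ i x) ≤
      ∑ i, a i ^ 2 * (Qform n s ε u univ (ξ i) + m * B * (∫ x, |ξ i x|) ^ 2) := by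
  have hcr := fun i j (h : i ≠ j) => integrable_cross_and_integral_le hs (hξ i).1.continuous
    (hξ j).1.continuous (hξ i).integrable (hξ j).integrable (hB i j h)
  set L : Fin (m + 1) → ℝ := fun i => ∫ x, |ξ i x| with hL
  have hd := fun i => (hξ i).integrable_sq_sub hn hs
  set G : Fin (m + 1) → Fin (m + 1) → Rn n × Rn n → ℝ := fun i j p => if i = j then 0 else
    |a i| * |a j| * (|ξ i p.1| * |ξ j (p.1 + p.2)| + |ξ j p.1| * |ξ i (p.1 + p.2)|) with hG
  have hGi : ∀ i j, Integrable (G i j) (pairMeasure n s) := fun i j => by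
    by_cases h : i = j
    · simp [hG, h]
    · simp only [hG, h, if_false]
      exact ((hcr i j h).1.add (hcr j i (Ne.symm h)).1).const_mul _
  have hGle : ∀ i j, ∫ p, G i j p ∂pairMeasure n s ≤
      2 * B * (if i = j then 0 else (|a i| * L i) * (|a j| * L j)) := fun i j => by
    by_cases h : i = j
    · simp [hG, h]
    · simp only [hG, h, if_false]
      rw [integral_const_mul, integral_add (hcr i j h).1 (hcr j i (Ne.symm h)).1]
      have h1 := add_le_add (hcr i j h).2 (hcr j i (Ne.symm h)).2
      have h2 := mul_le_mul_of_nonneg_left h1 (mul_nonneg (abs_nonneg (a i)) (abs_nonneg (a j)))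
      refine h2.trans_eq ?_
      simp only [hL]
      ring
  have hc : ∀ i, Continuous (ξ i) := fun i => (hξ i).1.continuous
  have hsum : IsCc1On n univ fun x => ∑ i, a i * ξ i x := by
    refine ⟨ContDiff.sum fun i _ => contDiff_const.mul (hξ i).1, ?_, subset_univ _⟩
    refine HasCompactSupport.intro (isCompact_iUnion fun i => (hξ i).2.1.isCompact) fun x hx => ?_
    refine Finset.sum_eq_zero fun i _ => ?_
    rw [image_eq_zero_of_notMem_tsupport fun h => hx (mem_iUnion.2 ⟨i, h⟩), mul_zero]
  have hjump : ∫ p, ((∑ i, a i * ξ i p.1) - ∑ i, a i * ξ i (p.1 + p.2)) ^ 2 ∂pairMeasure n s ≤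
      (∑ i, a i ^ 2 * ∫ p, (ξ i p.1 - ξ i (p.1 + p.2)) ^ 2 ∂pairMeasure n s) +
        ∑ i, ∑ j, ∫ p, G i j p ∂pairMeasure n s := by
    have i1 : Integrable (fun p : Rn n × Rn n => ∑ i, a i ^ 2 * (ξ i p.1 - ξ i (p.1 + p.2)) ^ 2)
      (pairMeasure n s) := integrable_finsetSum _ fun i _ => (hd i).const_mul _
    have i2 : Integrable (fun p : Rn n × Rn n => ∑ i, ∑ j, G i j p) (pairMeasure n s) :=
      integrable_finsetSum _ fun i _ => integrable_finsetSum _ fun j _ => hGi i j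
    refine (integral_mono (hsum.integrable_sq_sub hn hs) (i1.add i2) fun p => ?_).trans_eq ?_
    · exact sq_sum_sub_le_of_disjoint a (fun i => ξ i p.1) (fun i => ξ i (p.1 + p.2))
        (fun i j h => hdisj i j h _) fun i j h => hdisj i j h _
    · simp only [Pi.add_apply]
      rw [integral_add i1 i2, integral_finsetSum _ fun i _ => (hd i).const_mul _,
        integral_finsetSum _ fun i _ => integrable_finsetSum _ fun j _ => hGi i j]
      congr 1
      · simp only [integral_const_mul]
      · exact Finset.sum_congr rfl fun i _ => integral_finsetSum _ fun j _ => hGi i j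
  have hpot : ∫ x, (3 * u x ^ 2 - 1) * (∑ i, a i * ξ i x) ^ 2 =
      ∑ i, a i ^ 2 * ∫ x, (3 * u x ^ 2 - 1) * ξ i x ^ 2 := by
    have hi : ∀ i, Integrable fun x => (3 * u x ^ 2 - 1) * ξ i x ^ 2 := fun i => by
      refine Continuous.integrable_of_hasCompactSupport (by have := hc i; fun_prop) ?_
      refine HasCompactSupport.mul_left ?_
      exact (hξ i).2.1.comp_left (g := fun t : ℝ => t ^ 2) (by simp)
    have e : ∀ x, (3 * u x ^ 2 - 1) * (∑ i, a i * ξ i x) ^ 2 =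
        ∑ i, a i ^ 2 * ((3 * u x ^ 2 - 1) * ξ i x ^ 2) := fun x => by
      rw [sq (∑ i, a i * ξ i x), Finset.sum_mul_sum, Finset.mul_sum]
      refine Finset.sum_congr rfl fun i _ => ?_
      rw [Finset.sum_eq_single i]
      · ring
      · intro j _ hj
        linear_combination (a i * a j) * hdisj i j (Ne.symm hj) x
      · simp
    simp only [e]
    rw [integral_finsetSum _ fun i _ => (hi i).const_mul _]
    simp only [integral_const_mul]
  have hint : ∑ i, ∑ j, ∫ p, G i j p ∂pairMeasure n s ≤ 2 * B * (m * ∑ i, a i ^ 2 * L i ^ 2) := by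
    refine (Finset.sum_le_sum fun i _ => Finset.sum_le_sum fun j _ => hGle i j).trans ?_
    simp only [← Finset.mul_sum]
    refine mul_le_mul_of_nonneg_left ?_ (by positivity)
    refine (sum_sum_ite_ne_le fun i => |a i| * L i).trans_eq ?_
    simp only [mul_pow, sq_abs]
  have hnn : 0 ≤ B * (m * ∑ i, a i ^ 2 * L i ^ 2) :=
    mul_nonneg hB0 (mul_nonneg m.cast_nonneg (Finset.sum_nonneg fun i _ => by positivity))
  rw [Qform_univ hs, hpot]
  have e : ∑ i, a i ^ 2 * (Qform n s ε u univ (ξ i) + m * B * L i ^ 2) =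
      1 / 4 * (∑ i, a i ^ 2 * ∫ p, (ξ i p.1 - ξ i (p.1 + p.2)) ^ 2 ∂pairMeasure n s) +
      ε ^ (-s) * (∑ i, a i ^ 2 * ∫ x, (3 * u x ^ 2 - 1) * ξ i x ^ 2) +
      B * (m * ∑ i, a i ^ 2 * L i ^ 2) := by
    simp only [Finset.mul_sum, ← Finset.sum_add_distrib]
    refine Finset.sum_congr rfl fun i _ => ?_
    rw [Qform_univ hs]
    ring
  rw [e]
  linarith

lemma linearIndependent_of_disjoint {ι α : Type*} [Fintype ι] [DecidableEq ι] {ξ : ι → α → ℝ}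
    (hdisj : ∀ i j, i ≠ j → ∀ x, ξ i x * ξ j x = 0) (h0 : ∀ i, ξ i ≠ 0) :
    LinearIndependent ℝ ξ := by
  rw [Fintype.linearIndependent_iff]
  intro g hg k
  obtain ⟨x, hx⟩ := Function.ne_iff.1 (h0 k)
  have h1 := congrFun hg x
  rw [Finset.sum_apply, Finset.sum_eq_single k] at h1
  · exact (mul_eq_zero.1 h1).resolve_right hx
  · intro j _ hj
    have := (mul_eq_zero.1 (hdisj j k hj x)).resolve_right hx
    simp [this]
  · simp

end FiniteIndex

/-- **Finite Morse index implies almost stability in one out of `m+1` disjoint sets**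
(Lemma 3.12 of the paper, Euclidean version): if `u` solves fractional Allen–Cahn on `ℝ^n`
with Morse index at most `m`, and `U₁,…,U_{m+1}` are disjoint separated open sets, then for
any `Λ ≥ m·sup_{i≠j} sup_{U_i×U_j} K_s`, `u` is `Λ`-almost stable in some `U_k`. -/
theorem finite_index_implies_almost_stable
    (n : ℕ) (hn : 1 ≤ n) (s : ℝ) (hs : s ∈ Set.Ioo (0 : ℝ) 1)
    (ε : ℝ) (hε : 0 < ε) (m : ℕ)
    (u : Rn n → ℝ) (hrange : ∀ x, u x ∈ Set.Ioo (-1 : ℝ) 1)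
    (hlip : ∃ K : NNReal, LipschitzWith K u) (hC1 : ContDiff ℝ 1 u)
    (hsol : IsACSol n s ε u Set.univ)
    (hidx : ACMorseIndexLE n s ε u Set.univ m)
    (U : Fin (m + 1) → Set (Rn n)) (hopen : ∀ i, IsOpen (U i))
    (hdisj : ∀ i j, i ≠ j → Disjoint (U i) (U j))
    (hsep : ∀ i j, i ≠ j → 0 < setDist (U i) (U j))
    (Λ : ℝ)
    (hΛ : ∀ i j, i ≠ j → ∀ p ∈ U i, ∀ q ∈ U j, (m : ℝ) * fracKer n s p q ≤ Λ) :
    ∃ k : Fin (m + 1), ∀ ξ : Rn n → ℝ, IsCc1On n (U k) ξ →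
      -(Λ * (∫ x in U k, |ξ x|) ^ 2) ≤ Qform n s ε u Set.univ ξ := by
  rcases Nat.eq_zero_or_pos m with rfl | hm
  · obtain ⟨K, hK⟩ := hlip
    exact (not_stable hn hs hε (fun x => abs_lt.2 (hrange x)) hK hC1 (hsol.jumpOp_eq hs)
      fun ξ hξ => hidx.Qform_nonneg hs hξ).elim
  by_contra! hcon
  choose ξ hξ hneg using hcon
  have hL : ∀ i, ∫ x in U i, |ξ i x| = ∫ x, |ξ i x| := fun i =>
    setIntegral_eq_integral_of_forall_compl_eq_zero fun x hx => by
      rw [not_not.1 fun h => hx ((hξ i).mem_of_ne_zero h), abs_zero]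
  have hξ' : ∀ i, IsCc1On n univ (ξ i) := fun i => ⟨(hξ i).1, (hξ i).2.1, subset_univ _⟩
  have hdisj' : ∀ i j, i ≠ j → ∀ x, ξ i x * ξ j x = 0 := fun i j hij x => by
    by_contra h
    exact (hdisj i j hij).le_bot
      ⟨(hξ i).mem_of_ne_zero (left_ne_zero_of_mul h), (hξ j).mem_of_ne_zero (right_ne_zero_of_mul h)⟩
  have h0 : ∀ i, ξ i ≠ 0 := fun i h => by
    have := hneg i
    rw [h, Qform_zero] at this
    simp at this
  have hm' : (0 : ℝ) < m := by exact_mod_cast hm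
  have hB : ∀ i j, i ≠ j → ∀ x y, ξ i x ≠ 0 → ξ j y ≠ 0 → fracKer n s x y ≤ Λ / m :=
    fun i j hij x y hx hy => by
      rw [le_div_iff₀ hm', mul_comm]
      exact hΛ i j hij x ((hξ i).mem_of_ne_zero hx) y ((hξ j).mem_of_ne_zero hy)
  have hB0 : 0 ≤ Λ / m := by
    obtain ⟨x, hx⟩ := Function.ne_iff.1 (h0 0)
    obtain ⟨y, hy⟩ := Function.ne_iff.1 (h0 (Fin.last m))
    exact (fracKer_nonneg hs x y).trans
      (hB 0 (Fin.last m) (Fin.ne_of_val_ne (by simpa using hm.ne)) x y hx hy)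
  obtain ⟨a, ha, hQ⟩ := hidx ξ hξ' (linearIndependent_of_disjoint hdisj' h0)
  have hle := hQ.trans (Qform_sum_le hn hs hC1.continuous hξ' hdisj' hB0 hB a)
  have hterm : ∀ i, Qform n s ε u univ (ξ i) + m * (Λ / m) * (∫ x, |ξ i x|) ^ 2 < 0 := fun i => by
    have := hneg i
    rw [hL] at this
    rw [mul_div_cancel₀ _ hm'.ne']
    linarith
  obtain ⟨k, hk⟩ := Function.ne_iff.1 ha
  refine hle.not_gt (Finset.sum_neg' (fun i _ => ?_) ⟨k, Finset.mem_univ k, ?_⟩)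
  · exact mul_nonpos_of_nonneg_of_nonpos (sq_nonneg _) (hterm i).le
  · exact mul_neg_of_pos_of_neg (by have : a k ≠ 0 := hk; positivity) (hterm k)

end
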